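/- arXiv:1504.04538 — 4 statements merged into one kernel-verified Lean document; each statement's English description precedes it below -/
import Mathlib

section
/- Fix integers 1 ≤ m < n, constants R, L, d > 0 and α ∈ (0,1]. Let (Σ_j) be a sequence in the class C^{1,α}_{m,n}(R,L,d) that converges in the C^{1,α} graph-patch sense to Σ₀ ∈ C^{1,α}_{m,n}(R,L,d). Then there exist j₀ ∈ ℕ and a constant C_J > 0 depending only on R, L, α, m, n such that for every j ≥ j₀: (a) Σ_j and Σ₀ are ambient isotopic, and (b) there exists a C¹ diffeomorphism J_j : ℝⁿ → ℝⁿ with J_j(Σ_j) = Σ₀ and bilip(J_j) ≤ 1 + C_J · d_H(Σ₀, Σ_j)^{α/2}. -/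
open Set Metric MeasureTheory Filter Topology
open scoped ENNReal NNReal

noncomputable section

/-- `T` is an `m`-dimensional tangent plane for `S` at `x`, over which `S ∩ B(x,R)` is the
graph of a `1`-Lipschitz `C¹` function `f` with `f(0) = 0`, `Df(0) = 0` and `α`-Hölder
derivative with constant `L`. -/
def IsGraphPatchAt (m n : ℕ) (R L α : ℝ) (S : Set (EuclideanSpace ℝ (Fin n)))
    (x : EuclideanSpace ℝ (Fin n)) (T : Submodule ℝ (EuclideanSpace ℝ (Fin n))) : Prop :=
  Module.finrank ℝ T = m ∧
  ∃ f : T → Tᗮ, ContDiff ℝ 1 f ∧ f 0 = 0 ∧ fderiv ℝ f 0 = 0 ∧ LipschitzWith 1 f ∧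
    (∀ ξ η : T, ‖fderiv ℝ f ξ - fderiv ℝ f η‖ ≤ L * ‖ξ - η‖ ^ α) ∧
    S ∩ Metric.ball x R
      = (Set.range fun ξ : T =>
          x + (ξ : EuclideanSpace ℝ (Fin n)) + (f ξ : EuclideanSpace ℝ (Fin n)))
        ∩ Metric.ball x R

/-- The class `C^{1,α}_{m,n}(R,L,d)`: nonempty compact subsets of the closed ball of radius
`d` admitting uniform `C^{1,α}` graph patches at scale `R` with Hölder constant `L`. -/
def InClassC1 (m n : ℕ) (R L d α : ℝ) (S : Set (EuclideanSpace ℝ (Fin n))) : Prop :=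
  S.Nonempty ∧ IsCompact S ∧ S ⊆ Metric.closedBall 0 d ∧
  ∀ x ∈ S, ∃ T : Submodule ℝ (EuclideanSpace ℝ (Fin n)), IsGraphPatchAt m n R L α S x T

/-- A compact embedded `m`-dimensional submanifold of `ℝⁿ` of class `C^{1,α}`. -/
def IsC1AlphaSubmanifold (m n : ℕ) (α : ℝ) (S : Set (EuclideanSpace ℝ (Fin n))) : Prop :=
  S.Nonempty ∧ IsCompact S ∧
  ∀ x ∈ S, ∃ r : ℝ, 0 < r ∧ ∃ T : Submodule ℝ (EuclideanSpace ℝ (Fin n)),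
    Module.finrank ℝ T = m ∧ ∃ f : T → Tᗮ, ContDiff ℝ 1 f ∧
      (∃ C : ℝ, ∀ ξ η : T, ‖fderiv ℝ f ξ - fderiv ℝ f η‖ ≤ C * ‖ξ - η‖ ^ α) ∧
      S ∩ Metric.ball x r
        = (Set.range fun ξ : T =>
            x + (ξ : EuclideanSpace ℝ (Fin n)) + (f ξ : EuclideanSpace ℝ (Fin n)))
          ∩ Metric.ball x r

/-- `f` is `C¹` with `α`-Hölder derivative. -/
def C1Holder {E F : Type*} [NormedAddCommGroup E] [NormedSpace ℝ E]
    [NormedAddCommGroup F] [NormedSpace ℝ F] (α : ℝ) (f : E → F) : Prop :=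
  ContDiff ℝ 1 f ∧ ∃ C : ℝ, ∀ ξ η : E, ‖fderiv ℝ f ξ - fderiv ℝ f η‖ ≤ C * ‖ξ - η‖ ^ α

/-- `‖f − g‖_{C^{1,α'}} ≤ ε`: uniform closeness of the functions, of their derivatives, and
`ε`-smallness of the `α'`-Hölder seminorm of the difference of the derivatives. -/
def C1HolderClose {E F : Type*} [NormedAddCommGroup E] [NormedSpace ℝ E]
    [NormedAddCommGroup F] [NormedSpace ℝ F] (α' ε : ℝ) (f g : E → F) : Prop :=
  (∀ ξ : E, ‖f ξ - g ξ‖ ≤ ε) ∧ (∀ ξ : E, ‖fderiv ℝ f ξ - fderiv ℝ g ξ‖ ≤ ε) ∧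
  ∀ ξ η : E, ‖(fderiv ℝ f ξ - fderiv ℝ g ξ) - (fderiv ℝ f η - fderiv ℝ g η)‖ ≤ ε * ‖ξ - η‖ ^ α'

/-- Convergence of the sequence `Ss j` to `S₀` in the `C^{1,α}` graph-patch sense:
Hausdorff convergence, the limit is a `C^{1,α}` submanifold, and for large `j` both `Ss j`
and `S₀` are graphs over the tangent planes of `S₀` at a uniform scale `ρ`, the graph
functions of `Ss j` converging to those of `S₀` in `C^{1,α'}` for every `α' ∈ (0,α)`. -/
def GraphPatchConverges (m n : ℕ) (α : ℝ) (Ss : ℕ → Set (EuclideanSpace ℝ (Fin n)))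
    (S₀ : Set (EuclideanSpace ℝ (Fin n))) : Prop :=
  Filter.Tendsto (fun j => Metric.hausdorffDist (Ss j) S₀) Filter.atTop (nhds 0) ∧
  IsC1AlphaSubmanifold m n α S₀ ∧
  ∃ (j₀ : ℕ) (ρ : ℝ), 0 < ρ ∧ ∀ x ∈ S₀,
    ∃ T : Submodule ℝ (EuclideanSpace ℝ (Fin n)), Module.finrank ℝ T = m ∧
    ∃ (f : ℕ → T → Tᗮ) (f₀ : T → Tᗮ),
      (C1Holder α f₀ ∧
        S₀ ∩ Metric.ball x ρ
          = (Set.range fun ξ : T =>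
              x + (ξ : EuclideanSpace ℝ (Fin n)) + (f₀ ξ : EuclideanSpace ℝ (Fin n)))
            ∩ Metric.ball x ρ) ∧
      (∀ j, j₀ ≤ j → C1Holder α (f j) ∧
        Ss j ∩ Metric.ball x ρ
          = (Set.range fun ξ : T =>
              x + (ξ : EuclideanSpace ℝ (Fin n)) + (f j ξ : EuclideanSpace ℝ (Fin n)))
            ∩ Metric.ball x ρ) ∧
      (∀ α' : ℝ, 0 < α' → α' < α → ∀ ε : ℝ, 0 < ε →
        ∃ J : ℕ, ∀ j, J ≤ j → C1HolderClose α' ε (f j) f₀)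

/-- Two subsets of `ℝⁿ` are ambient isotopic: there is a continuous family of topological
embeddings of `ℝⁿ` into itself, ending at the identity, carrying `S₂` onto `S₁` at time `0`. -/
def AmbientIsotopic (n : ℕ) (S₁ S₂ : Set (EuclideanSpace ℝ (Fin n))) : Prop :=
  ∃ H : EuclideanSpace ℝ (Fin n) × ℝ → EuclideanSpace ℝ (Fin n),
    Continuous H ∧
    (∀ t ∈ Set.Icc (0 : ℝ) 1, IsEmbedding fun x => H (x, t)) ∧
    (∀ x, H (x, 1) = x) ∧
    (fun x => H (x, 0)) '' S₂ = S₁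

/-- `J` is a `C¹` diffeomorphism of `ℝⁿ` with inverse `Jinv`. -/
def IsC1DiffeoWithInv {n : ℕ} (J Jinv : EuclideanSpace ℝ (Fin n) → EuclideanSpace ℝ (Fin n)) :
    Prop :=
  ContDiff ℝ 1 J ∧ ContDiff ℝ 1 Jinv ∧
  Function.LeftInverse Jinv J ∧ Function.RightInverse Jinv J

structure Patch {E : Type*} [NormedAddCommGroup E] [InnerProductSpace ℝ E]
    (m : ℕ) (R L α : ℝ) (S : Set E) (x : E) (T : Submodule ℝ E) (F : E → E) : Prop where
  rank : Module.finrank ℝ T = m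
  cd : ContDiff ℝ 1 F
  lip : ∀ y y', ‖F y - F y'‖ ≤ 2 * ‖y - y'‖
  hol : ∀ y y', ‖fderiv ℝ F y - fderiv ℝ F y'‖ ≤ L * ‖y - y'‖ ^ α
  mem : ∀ y, dist y x < R → (y ∈ S ↔ F y = 0)
  retr : ∀ y, F (y - F y) = 0
  ker : ∀ v, fderiv ℝ F x v = 0 ↔ v ∈ T
  nor : ∀ v ∈ Tᗮ, F (x + v) = v

theorem patch_exists {E : Type*} [NormedAddCommGroup E] [InnerProductSpace ℝ E]
    [FiniteDimensional ℝ E] (m : ℕ) (R L α : ℝ) (hL : 0 ≤ L) (hα : 0 ≤ α) (S : Set E) (x : E)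
    (T : Submodule ℝ E) (hT : Module.finrank ℝ T = m) (f : T → Tᗮ) (hf : ContDiff ℝ 1 f)
    (h0 : f 0 = 0) (hd0 : fderiv ℝ f 0 = 0) (hlip : LipschitzWith 1 f)
    (hhol : ∀ ξ η : T, ‖fderiv ℝ f ξ - fderiv ℝ f η‖ ≤ L * ‖ξ - η‖ ^ α)
    (hS : S ∩ Metric.ball x R
      = (Set.range fun ξ : T => x + (ξ : E) + (f ξ : E)) ∩ Metric.ball x R) :
    ∃ F : E → E, Patch m R L α S x T F := by
  set P := T.orthogonalProjectionOnto with hP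
  set Q := Tᗮ.orthogonalProjectionOnto with hQ
  have hPQ : ∀ v : E, (P v : E) + (Q v : E) = v := fun v => by
    simp [hP, hQ]
  have hP1 : ∀ v : E, ‖P v‖ ≤ ‖v‖ := fun v => T.norm_orthogonalProjectionOnto_apply_le v
  have hQ1 : ∀ v : E, ‖Q v‖ ≤ ‖v‖ := fun v => Tᗮ.norm_orthogonalProjectionOnto_apply_le v
  have hPT : ∀ ξ : T, P (ξ : E) = ξ := fun ξ => by simp [hP]
  have hQN : ∀ ξ : Tᗮ, Q (ξ : E) = ξ := fun ξ => by simp [hQ]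
  have hPN : ∀ ξ : Tᗮ, P (ξ : E) = 0 := fun ξ =>
    Submodule.orthogonalProjectionOnto_eq_zero_iff.2 ξ.2
  have hQT : ∀ ξ : T, Q (ξ : E) = 0 := fun ξ => by
    apply Submodule.orthogonalProjectionOnto_eq_zero_iff.2
    simp
  set F : E → E := fun y => ((Q (y - x) : E)) - (f (P (y - x)) : E) with hF
  have hder : ∀ y, HasFDerivAt F (Tᗮ.subtypeL ∘L Q -
      Tᗮ.subtypeL ∘L (fderiv ℝ f (P (y - x)) ∘L P)) y := by
    intro y
    have h1 : HasFDerivAt (fun y : E => y - x) (ContinuousLinearMap.id ℝ E) y :=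
      (hasFDerivAt_id y).sub_const x
    have h2 : HasFDerivAt (fun y : E => P (y - x)) P y := by
      have := P.hasFDerivAt.comp y h1; rwa [ContinuousLinearMap.comp_id] at this
    have h3 : HasFDerivAt (fun y : E => ((Q (y - x) : E))) (Tᗮ.subtypeL ∘L Q) y := by
      have := (Tᗮ.subtypeL ∘L Q).hasFDerivAt.comp y h1; rwa [ContinuousLinearMap.comp_id] at this
    have h4 := ((hf.differentiable (by norm_num)) (P (y - x))).hasFDerivAt
    have h5 := (Tᗮ.subtypeL).hasFDerivAt.comp y (h4.comp y h2)
    exact h3.sub h5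
  have hfd : ∀ y, fderiv ℝ F y = _ := fun y => (hder y).fderiv
  refine ⟨F, hT, ?_, ?_, ?_, ?_, ?_, ?_, ?_⟩
  · have h1 : ContDiff ℝ 1 (fun y : E => y - x) := contDiff_id.sub contDiff_const
    exact ((Tᗮ.subtypeL ∘L Q).contDiff.comp h1).sub
      (Tᗮ.subtypeL.contDiff.comp (hf.comp (P.contDiff.comp h1)))
  · intro y y'
    have e : F y - F y' = (Q (y - y') : E) - ((f (P (y - x)) - f (P (y' - x)) : Tᗮ) : E) := by
      have : Q (y - y') = Q (y - x) - Q (y' - x) := by rw [← map_sub]; congr 1; abel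
      rw [this]; simp only [hF, Submodule.coe_sub]; abel
    rw [e]
    have h1 : ‖(Q (y - y') : E)‖ ≤ ‖y - y'‖ := hQ1 _
    have h2 : ‖((f (P (y - x)) - f (P (y' - x)) : Tᗮ) : E)‖ ≤ ‖y - y'‖ := by
      have := hlip.dist_le_mul (P (y - x)) (P (y' - x))
      rw [dist_eq_norm, dist_eq_norm, ← map_sub] at this
      have e2 : y - x - (y' - x) = y - y' := by abel
      rw [e2] at this
      simp only [NNReal.coe_one, one_mul] at this
      exact this.trans (hP1 _)
    linarith [norm_sub_le (Q (y - y') : E) ((f (P (y - x)) - f (P (y' - x)) : Tᗮ) : E)]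
  · intro y y'
    rw [hfd, hfd]
    have h0' : 0 ≤ L * ‖y - y'‖ ^ α := by positivity
    refine ContinuousLinearMap.opNorm_le_bound _ h0' fun v => ?_
    have e : (Tᗮ.subtypeL ∘L Q - Tᗮ.subtypeL ∘L (fderiv ℝ f (P (y - x)) ∘L P) -
        (Tᗮ.subtypeL ∘L Q - Tᗮ.subtypeL ∘L (fderiv ℝ f (P (y' - x)) ∘L P))) v =
        -((((fderiv ℝ f (P (y - x)) - fderiv ℝ f (P (y' - x))) (P v) : Tᗮ)) : E) := by
      simp
    rw [e, norm_neg]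
    have h1 := (fderiv ℝ f (P (y - x)) - fderiv ℝ f (P (y' - x))).le_opNorm (P v)
    have h2 := hhol (P (y - x)) (P (y' - x))
    rw [← map_sub] at h2
    have e2 : y - x - (y' - x) = y - y' := by abel
    rw [e2] at h2
    have h3 : ‖P (y - y')‖ ^ α ≤ ‖y - y'‖ ^ α :=
      Real.rpow_le_rpow (norm_nonneg _) (hP1 _) hα
    calc _ ≤ _ := h1
      _ ≤ (L * ‖y - y'‖ ^ α) * ‖v‖ := by
        gcongr
        · exact h2.trans (by gcongr)
        · exact hP1 v
  · intro y hy
    have hyb : y ∈ ball x R := hy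
    have : y ∈ S ↔ y ∈ Set.range fun ξ : T => x + (ξ : E) + (f ξ : E) := by
      have := Set.ext_iff.1 hS y
      simpa [hyb, -mem_ball] using this
    rw [this]
    constructor
    · rintro ⟨ξ, rfl⟩
      have e : x + (ξ : E) + (f ξ : E) - x = (ξ : E) + (f ξ : E) := by abel
      simp only [hF, e, map_add, hPT, hPN, hQT, hQN]
      simp
    · intro h
      refine ⟨P (y - x), ?_⟩
      have := hPQ (y - x)
      have h' : (Q (y - x) : E) = (f (P (y - x)) : E) := sub_eq_zero.1 h
      rw [h'] at this
      simp only
      rw [add_assoc, this]; abel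
  · intro y
    have e : y - F y - x = (P (y - x) : E) + (f (P (y - x)) : E) := by
      have := hPQ (y - x)
      simp only [hF]
      rw [show y - ((Q (y - x) : E) - (f (P (y - x)) : E)) - x
        = (y - x) - (Q (y - x) : E) + (f (P (y - x)) : E) by abel]
      nth_rewrite 1 [← this]; abel
    have : F (y - F y) = (Q (y - F y - x) : E) - (f (P (y - F y - x)) : E) := rfl
    rw [this, e]
    simp only [map_add, hPT, hPN, hQT, hQN]
    simp
  · intro v
    rw [hfd]
    have : P (x - x) = 0 := by simp
    rw [this, hd0]
    simp [hQ, sub_eq_zero, eq_comm (a := v), Submodule.starProjection_eq_self_iff]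
  · intro v hv
    have h1 := hPN ⟨v, hv⟩
    have h2 := hQN ⟨v, hv⟩
    simp only at h1 h2
    simp [hF, h1, h2, h0]

theorem exists_net {E : Type*} [MetricSpace E] (S : Set E) (hS : IsCompact S) (r : ℝ)
    (hr : 0 < r) : ∃ X : Finset E, (∀ x ∈ X, x ∈ S) ∧
      (∀ x ∈ X, ∀ y ∈ X, x ≠ y → r ≤ dist x y) ∧ ∀ y ∈ S, ∃ x ∈ X, dist y x ≤ r := by
  classical
  let ε : ℝ≥0 := ⟨r, hr.le⟩
  have hε : ε ≠ 0 := fun h => hr.ne' (congrArg NNReal.toReal h)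
  have hp : packingNumber ε S ≠ ⊤ := by
    have hε2 : ε / 2 ≠ 0 := by simpa using hε
    obtain ⟨N, hN, hNf, hNc⟩ := exists_finite_isCover_of_totallyBounded hε2 hS.totallyBounded
    have h1 := packingNumber_two_mul_le_externalCoveringNumber (ε / 2) S
    rw [mul_div_cancel₀ ε two_ne_zero] at h1
    have h2 : externalCoveringNumber (ε / 2) S ≤ N.encard := hNc.externalCoveringNumber_le_encard
    exact ((h1.trans h2).trans_lt hNf.encard_lt_top).ne
  have h1 := isCover_maximalSeparatedSet hp
  have h2 : IsSeparated ε (maximalSeparatedSet ε S) := isSeparated_maximalSeparatedSet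
  have h3 : (maximalSeparatedSet ε S).Finite := by
    rw [← Set.encard_lt_top_iff, encard_maximalSeparatedSet hp]; exact hp.lt_top
  refine ⟨h3.toFinset, fun x hx => maximalSeparatedSet_subset (h3.mem_toFinset.1 hx), ?_, ?_⟩
  · intro x hx y hy hxy
    have : (ε : ℝ≥0∞) < edist x y := h2 (h3.mem_toFinset.1 hx) (h3.mem_toFinset.1 hy) hxy
    rw [edist_nndist] at this
    have h4 : ε < nndist x y := by exact_mod_cast this
    exact le_of_lt (by exact_mod_cast h4)
  · intro y hy
    obtain ⟨x, hx, hxy⟩ := h1 hy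
    refine ⟨x, h3.mem_toFinset.2 hx, ?_⟩
    have hxy' : edist y x ≤ ε := hxy
    rw [edist_nndist] at hxy'
    have h4 : nndist y x ≤ ε := by exact_mod_cast hxy'
    exact_mod_cast h4
theorem card_net {E : Type*} [NormedAddCommGroup E] [NormedSpace ℝ E] [FiniteDimensional ℝ E]
    [DecidableEq E] (X : Finset E) (r : ℝ) (hr : 0 < r)
    (hX : ∀ x ∈ X, ∀ y ∈ X, x ≠ y → r ≤ dist x y) (y : E)
    (hy : ∀ x ∈ X, dist y x ≤ 2 * r) : X.card ≤ Besicovitch.multiplicity E := by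
  have hinj : Function.Injective (fun x : E => r⁻¹ • (x - y)) := by
    intro a b hab
    have := smul_right_injective E (inv_ne_zero hr.ne') hab
    simpa using this
  rw [← Finset.card_image_of_injective X hinj]
  apply Besicovitch.card_le_multiplicity
  · intro c hc
    obtain ⟨x, hx, rfl⟩ := Finset.mem_image.1 hc
    have := hy x hx
    rw [dist_comm, dist_eq_norm] at this
    rw [norm_smul, Real.norm_of_nonneg (inv_nonneg.2 hr.le), inv_mul_le_iff₀ hr]
    linarith
  · intro c hc d hd hcd
    obtain ⟨x, hx, rfl⟩ := Finset.mem_image.1 hc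
    obtain ⟨z, hz, rfl⟩ := Finset.mem_image.1 hd
    have hxz : x ≠ z := fun h => hcd (by rw [h])
    have := hX x hx z hz hxz
    rw [dist_eq_norm] at this
    rw [← smul_sub, norm_smul, Real.norm_of_nonneg (inv_nonneg.2 hr.le), sub_sub_sub_cancel_right,
      le_inv_mul_iff₀ hr]
    linarith
theorem taylor_hol {E F : Type*} [NormedAddCommGroup E] [NormedSpace ℝ E]
    [NormedAddCommGroup F] [NormedSpace ℝ F] (f : E → F) (hf : ContDiff ℝ 1 f) (L α : ℝ)
    (hL : 0 ≤ L) (hα : 0 ≤ α)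
    (h : ∀ y y', ‖fderiv ℝ f y - fderiv ℝ f y'‖ ≤ L * ‖y - y'‖ ^ α) (x v : E) :
    ‖f (x + v) - f x - fderiv ℝ f x v‖ ≤ L * ‖v‖ ^ α * ‖v‖ := by
  have := (convex_closedBall x ‖v‖).norm_image_sub_le_of_norm_fderiv_le' (𝕜 := ℝ) (f := f)
    (φ := fderiv ℝ f x) (C := L * ‖v‖ ^ α) (x := x) (y := x + v)
    (fun y _ => (hf.differentiable (by norm_num)) y) (fun y hy => ?_)
    (by simp) (by simp)
  · simpa using this
  · refine (h y x).trans ?_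
    have : ‖y - x‖ ≤ ‖v‖ := by simpa [dist_eq_norm] using hy
    gcongr
theorem exists_bump (E : Type*) [NormedAddCommGroup E] [InnerProductSpace ℝ E]
    [FiniteDimensional ℝ E] (r : ℝ) (hr : 0 < r) : ∃ B : ℝ, 0 ≤ B ∧ ∀ a : E, ∃ φ : E → ℝ,
      ContDiff ℝ 1 φ ∧ (∀ y, 0 ≤ φ y) ∧ (∀ y, φ y ≤ 1) ∧ (∀ y, dist y a ≤ r → φ y = 1) ∧
      (∀ y, 2 * r ≤ dist y a → φ y = 0) ∧ (∀ y, 2 * r ≤ dist y a → fderiv ℝ φ y = 0) ∧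
      ∀ y, ‖fderiv ℝ φ y‖ ≤ B := by
  let ψ : ContDiffBump (0 : E) := ⟨r, 2 * r, hr, by linarith⟩
  have hψ : ContDiff ℝ 1 ψ := ψ.contDiff
  have hc : Continuous (fderiv ℝ ψ) := hψ.continuous_fderiv (by norm_num)
  obtain ⟨B, hB⟩ := (ψ.hasCompactSupport.fderiv (𝕜 := ℝ)).exists_bound_of_continuous hc
  refine ⟨B, (norm_nonneg _).trans (hB 0), fun a => ?_⟩
  have hd : ∀ y, fderiv ℝ (fun y => ψ (y - a)) y = fderiv ℝ ψ (y - a) := fun y => by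
    rw [fderiv_comp_sub]
  have h0 : ∀ y, 2 * r ≤ dist y a → ψ (y - a) = 0 := fun y hy =>
    ψ.zero_of_le_dist (by simpa [dist_eq_norm] using hy)
  refine ⟨fun y => ψ (y - a), hψ.comp (contDiff_id.sub contDiff_const), fun y => ψ.nonneg,
    fun y => ψ.le_one, fun y hy => ψ.one_of_mem_closedBall ?_, h0, ?_, fun y => ?_⟩
  · simpa [dist_eq_norm] using hy
  · intro y hy
    apply IsLocalMin.fderiv_eq_zero
    refine Filter.Eventually.of_forall fun z => ?_
    simp only [h0 y hy]; exact ψ.nonneg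
  · rw [hd]; exact hB _

theorem Patch.zero {E : Type*} [NormedAddCommGroup E] [InnerProductSpace ℝ E]
    {m : ℕ} {R L α : ℝ} {S : Set E} {x : E} {T : Submodule ℝ E} {F : E → E}
    (h : Patch m R L α S x T F) : F x = 0 := by
  simpa using h.nor 0 (Submodule.zero_mem _)

theorem Patch.near {E : Type*} [NormedAddCommGroup E] [InnerProductSpace ℝ E]
    {m : ℕ} {R L α : ℝ} {S S' : Set E} {z : E} {T : Submodule ℝ E} {F : E → E}
    (hp : Patch m R L α S' z T F) {h : ℝ} (hn : ∀ y ∈ S, ∃ w ∈ S', dist y w ≤ h)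
    {q : E} (hq : q ∈ S) (hd : dist q z + h < R) (u : E) :
    ‖F u‖ ≤ 2 * (dist u q + h) := by
  obtain ⟨w, hw, hqw⟩ := hn q hq
  have h1 : dist w z < R := by
    linarith [dist_triangle w q z, dist_comm w q]
  have h2 : F w = 0 := (hp.mem w h1).1 hw
  have h3 := hp.lip u w
  rw [h2, sub_zero, ← dist_eq_norm] at h3
  linarith [dist_triangle u q w]

theorem Patch.retr_mem {E : Type*} [NormedAddCommGroup E] [InnerProductSpace ℝ E]
    {m : ℕ} {R L α : ℝ} {S : Set E} {x : E} {T : Submodule ℝ E} {F : E → E}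
    (hp : Patch m R L α S x T F) {y : E} (hy : 3 * dist y x < R) :
    y - F y ∈ S ∧ dist (y - F y) x ≤ 3 * dist y x := by
  have h1 := hp.lip y x
  rw [hp.zero, sub_zero, ← dist_eq_norm] at h1
  have h2 : dist (y - F y) y = ‖F y‖ := by simp [dist_eq_norm]
  have h3 : dist (y - F y) x ≤ 3 * dist y x := by
    linarith [dist_triangle (y - F y) y x]
  exact ⟨(hp.mem _ (by linarith)).2 (hp.retr y), h3⟩

/-- The tangency estimate. -/
theorem tangency {E : Type*} [NormedAddCommGroup E] [InnerProductSpace ℝ E]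
    {m : ℕ} {R L α : ℝ} (hL : 0 ≤ L) (hα : 0 < α) (hα1 : α ≤ 1) {S S' : Set E} {z q : E}
    {T T' : Submodule ℝ E} {F F' : E → E}
    (hq : q ∈ S) (hp : Patch m R L α S q T F) (hp' : Patch m R L α S' z T' F')
    {t : ℝ} (ht : 0 < t) (ht1 : t ≤ 1)
    (hn : ∀ y ∈ S, ∃ w ∈ S', dist y w ≤ t ^ 2) (hd : dist q z + 3 * t + t ^ 2 < R)
    {τ : E} (hτ : τ ∈ T) :
    ‖fderiv ℝ F' q τ‖ ≤ (4 + 3 * L) * t ^ α * ‖τ‖ := by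
  rcases eq_or_ne τ 0 with rfl | hτ0
  · simp
  have hτp : 0 < ‖τ‖ := norm_pos_iff.2 hτ0
  set v : E := (t / ‖τ‖) • τ with hv
  have hvn : ‖v‖ = t := by
    rw [hv, norm_smul, Real.norm_of_nonneg (by positivity)]; field_simp
  have hvT : v ∈ T := T.smul_mem _ hτ
  have hdz : 0 ≤ dist q z := dist_nonneg
  have hdv : dist (q + v) q = t := by simp [dist_eq_norm, hvn]
  obtain ⟨hqt, hqtd⟩ := hp.retr_mem (y := q + v) (by rw [hdv]; nlinarith)
  rw [hdv] at hqtd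
  set qt := q + v - F (q + v) with hqtdef
  have e1 : ‖F (q + v)‖ ≤ L * t ^ α * t := by
    have := taylor_hol F hp.cd L α hL hα.le hp.hol q v
    rw [hp.zero, (hp.ker v).2 hvT, hvn] at this
    simpa using this
  have e2 : ‖F' (q + v) - F' q - fderiv ℝ F' q v‖ ≤ L * t ^ α * t := by
    have := taylor_hol F' hp'.cd L α hL hα.le hp'.hol q v
    rwa [hvn] at this
  have e3 : ‖F' qt‖ ≤ 2 * t ^ 2 := by
    have := hp'.near hn hqt (by linarith [dist_triangle qt q z]) qt
    simpa using this
  have e4 : ‖F' q‖ ≤ 2 * t ^ 2 := by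
    have := hp'.near hn hq (by linarith) q
    simpa using this
  have e5 : ‖F' (q + v) - F' qt‖ ≤ 2 * (L * t ^ α * t) := by
    refine (hp'.lip _ _).trans ?_
    have : q + v - qt = F (q + v) := by rw [hqtdef]; abel
    rw [this]; linarith
  have e6 : ‖fderiv ℝ F' q v‖ ≤ 4 * t ^ 2 + 3 * (L * t ^ α * t) := by
    have : fderiv ℝ F' q v = -(F' (q + v) - F' q - fderiv ℝ F' q v) + (F' (q + v) - F' qt)
        + (F' qt - F' q) := by abel
    rw [this]
    have a1 := norm_add₃_le (a := -(F' (q + v) - F' q - fderiv ℝ F' q v))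
      (b := F' (q + v) - F' qt) (c := F' qt - F' q)
    rw [norm_neg] at a1
    linarith [norm_sub_le (F' qt) (F' q)]
  have e7 : t ≤ t ^ α := by
    simpa using Real.rpow_le_rpow_of_exponent_ge ht ht1 hα1
  have e8 : fderiv ℝ F' q v = (t / ‖τ‖) • fderiv ℝ F' q τ := by rw [hv, map_smul]
  rw [e8, norm_smul, Real.norm_of_nonneg (by positivity)] at e6
  have e9 : t * ‖fderiv ℝ F' q τ‖ ≤ t * ((4 + 3 * L) * t ^ α * ‖τ‖) := by
    have : t * ‖fderiv ℝ F' q τ‖ = (t / ‖τ‖ * ‖fderiv ℝ F' q τ‖) * ‖τ‖ := by field_simp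
    rw [this]
    have : 4 * t ^ 2 + 3 * (L * t ^ α * t) ≤ t * ((4 + 3 * L) * t ^ α) := by nlinarith
    calc _ ≤ (4 * t ^ 2 + 3 * (L * t ^ α * t)) * ‖τ‖ := by gcongr
      _ ≤ (t * ((4 + 3 * L) * t ^ α)) * ‖τ‖ := by gcongr
      _ = _ := by ring
  exact le_of_mul_le_mul_left e9 ht

/-- The derivative of the local retraction is tangent. -/
theorem retr_tangent {E : Type*} [NormedAddCommGroup E] [InnerProductSpace ℝ E]
    {m : ℕ} {R L α : ℝ} {S : Set E} {a y : E}
    {T T' : Submodule ℝ E} {F F' : E → E} (hR : 0 < R)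
    (hp : Patch m R L α S a T F) (hp' : Patch m R L α S (y - F y) T' F')
    (hy : 3 * dist y a < R) (v : E) : v - fderiv ℝ F y v ∈ T' := by
  rw [← hp'.ker]
  have hFd : Differentiable ℝ F := hp.cd.differentiable (by norm_num)
  have hFd' : Differentiable ℝ F' := hp'.cd.differentiable (by norm_num)
  have h1 : HasFDerivAt (fun y => y - F y) (ContinuousLinearMap.id ℝ E - fderiv ℝ F y) y :=
    (hasFDerivAt_id y).sub (hFd y).hasFDerivAt
  have h2 := (hFd' (y - F y)).hasFDerivAt.comp y h1
  have hcont : Continuous (fun y => y - F y) := continuous_id.sub hp.cd.continuous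
  have h3 : (F' ∘ fun y => y - F y) =ᶠ[𝓝 y] fun _ => 0 := by
    have n1 : ∀ᶠ u in 𝓝 y, 3 * dist u a < R :=
      (continuous_const.mul (continuous_id.dist continuous_const)).continuousAt.eventually_lt_const hy
    have n2 : ∀ᶠ u in 𝓝 y, dist (u - F u) (y - F y) < R :=
      (hcont.dist continuous_const).continuousAt.eventually_lt_const (by simpa using hR)
    filter_upwards [n1, n2] with u hu1 hu2
    exact (hp'.mem _ hu2).1 (hp.retr_mem hu1).1
  have h4 : HasFDerivAt (F' ∘ fun y => y - F y) (0 : E →L[ℝ] E) y :=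
    (hasFDerivAt_const (0 : E) y).congr_of_eventuallyEq h3
  have h5 := h2.unique h4
  have h6 := congrArg (fun A : E →L[ℝ] E => A v) h5
  simpa using h6


/-- number of active centers -/
def cnt {E : Type*} [NormedAddCommGroup E] (r : ℝ) (s : Finset E) (y : E) : ℕ := by
  classical exact (s.filter fun x => dist y x < 2 * r).card

structure StepInv {E : Type*} [NormedAddCommGroup E] [InnerProductSpace ℝ E]
    (r t α M C2 : ℝ) (S S' : Set E) (T : E → Submodule ℝ E) (s : Finset E) (J : E → E) :
    Prop where
  cd : ContDiff ℝ 1 J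
  disp : ∀ y ∈ S, ‖J y - y‖ ≤ M ^ cnt r s y * t ^ 2
  tan : ∀ y ∈ S, ∀ τ ∈ T y, ‖fderiv ℝ J y τ - τ‖ ≤ M ^ cnt r s y * t ^ α * ‖τ‖
  hit : ∀ y ∈ S, (∃ x ∈ s, dist y x ≤ r) → J y ∈ S'
  glob : ∀ y v, ‖fderiv ℝ J y v - v‖ ≤ cnt r s y * (C2 * t ^ α) * ‖v‖

theorem core {E : Type*} [NormedAddCommGroup E] [InnerProductSpace ℝ E]
    {m : ℕ} {r R L α : ℝ} (hL : 0 ≤ L) (hα : 0 < α) (hα1 : α ≤ 1) (hr : 0 < r)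
    (hRr : R = 16 * r) {S S' : Set E}
    {T : E → Submodule ℝ E} {F : E → E → E} (hp : ∀ x ∈ S, Patch m R L α S x (T x) (F x))
    {z a : E} {T' : Submodule ℝ E} {F' : E → E} (hp' : Patch m R L α S' z T' F')
    {t : ℝ} (ht : 0 < t) (ht1 : t ≤ 1) (htr : 8 * t ≤ r)
    (hn : ∀ y ∈ S, ∃ w ∈ S', dist y w ≤ t ^ 2)
    (haS : a ∈ S) (haz : dist a z ≤ t ^ 2)
    {J : E → E} (hJ : ContDiff ℝ 1 J) {K y : E} {k : ℝ} (hk : 1 ≤ k)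
    (hkL : L * (k * t ^ 2) ^ α ≤ t ^ α)
    (hya : dist y a < 2 * r)
    (hdisp : ‖J (y - F a y) - (y - F a y)‖ ≤ k * t ^ 2)
    (htan : ∀ τ ∈ T (y - F a y), ‖fderiv ℝ J (y - F a y) τ - τ‖ ≤ k * t ^ α * ‖τ‖) :
    ‖F' (J (y - F a y))‖ ≤ 2 * (k + 1) * t ^ 2 ∧
    ∀ v, ‖fderiv ℝ (fun y => F' (J (y - F a y))) y v‖
      ≤ 3 * (2 * k + 5 + 3 * L) * t ^ α * ‖v‖ := by
  have hpa := hp a haS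
  have htt : t ^ 2 ≤ t := by nlinarith
  obtain ⟨hqS, hqa⟩ := hpa.retr_mem (y := y) (by linarith)
  set q := y - F a y with hq
  have hqz : dist q z ≤ 6 * r + t ^ 2 := by linarith [dist_triangle q a z]
  constructor
  · have := hp'.near hn hqS (by linarith) (J q)
    rw [dist_eq_norm] at this
    linarith
  intro v
  have hFd : Differentiable ℝ (F a) := hpa.cd.differentiable (by norm_num)
  have hFd' : Differentiable ℝ F' := hp'.cd.differentiable (by norm_num)
  have hJd : Differentiable ℝ J := hJ.differentiable (by norm_num)
  have h1 : HasFDerivAt (fun y => y - F a y) (ContinuousLinearMap.id ℝ E - fderiv ℝ (F a) y) y :=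
    (hasFDerivAt_id y).sub (hFd y).hasFDerivAt
  have h2 : HasFDerivAt (fun y => F' (J (y - F a y))) _ y :=
    (hFd' (J q)).hasFDerivAt.comp y ((hJd q).hasFDerivAt.comp y h1)
  rw [h2.fderiv]
  set τ := v - fderiv ℝ (F a) y v with hτ
  have hτT : τ ∈ T q := retr_tangent (by linarith) hpa (hp q hqS) (by linarith) v
  have lipop : ∀ (G : E → E), (∀ y y', ‖G y - G y'‖ ≤ 2 * ‖y - y'‖) → ∀ x w,
      ‖fderiv ℝ G x w‖ ≤ 2 * ‖w‖ := by
    intro G hG x w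
    have hl : LipschitzWith 2 G := LipschitzWith.of_dist_le_mul fun a b => by
      simpa [dist_eq_norm] using hG a b
    have := norm_fderiv_le_of_lipschitz ℝ hl (x₀ := x)
    exact ((fderiv ℝ G x).le_opNorm w).trans (by gcongr; simpa using this)
  have hτn : ‖τ‖ ≤ 3 * ‖v‖ := by
    linarith [norm_sub_le v (fderiv ℝ (F a) y v), lipop _ hpa.lip y v]
  have b1 : ‖fderiv ℝ F' (J q) (fderiv ℝ J q τ - τ)‖ ≤ 2 * (k * t ^ α * ‖τ‖) :=
    (lipop _ hp'.lip _ _).trans (by linarith [htan τ hτT])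
  have b2 : ‖(fderiv ℝ F' (J q) - fderiv ℝ F' q) τ‖ ≤ t ^ α * ‖τ‖ := by
    refine (ContinuousLinearMap.le_opNorm _ _).trans ?_
    gcongr
    refine (hp'.hol _ _).trans (le_trans ?_ hkL)
    gcongr
  have b3 : ‖fderiv ℝ F' q τ‖ ≤ (4 + 3 * L) * t ^ α * ‖τ‖ :=
    tangency hL hα hα1 hqS (hp q hqS) hp' ht ht1 hn (by linarith) hτT
  have e : (fderiv ℝ F' (J q) ∘L fderiv ℝ J q ∘L
      (ContinuousLinearMap.id ℝ E - fderiv ℝ (F a) y)) v =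
      fderiv ℝ F' (J q) (fderiv ℝ J q τ - τ) + (fderiv ℝ F' (J q) - fderiv ℝ F' q) τ
        + fderiv ℝ F' q τ := by
    simp [hτ]
  change ‖(fderiv ℝ F' (J q) ∘L fderiv ℝ J q ∘L
      (ContinuousLinearMap.id ℝ E - fderiv ℝ (F a) y)) v‖ ≤ _
  rw [e]
  have htα : 0 < t ^ α := Real.rpow_pos_of_pos ht α
  calc _ ≤ _ := norm_add₃_le
    _ ≤ (2 * k + 5 + 3 * L) * t ^ α * ‖τ‖ := by linarith
    _ ≤ (2 * k + 5 + 3 * L) * t ^ α * (3 * ‖v‖) := by gcongr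
    _ = _ := by ring

theorem cnt_insert_pos {E : Type*} [NormedAddCommGroup E] [DecidableEq E] {r : ℝ} {s : Finset E}
    {a y : E} (ha : a ∉ s) (hy : dist y a < 2 * r) :
    cnt r (insert a s) y = cnt r s y + 1 := by
  classical
  unfold cnt
  have : ({x ∈ insert a s | dist y x < 2 * r} : Finset E)
      = insert a ({x ∈ s | dist y x < 2 * r} : Finset E) := by
    ext x; simp only [Finset.mem_filter, Finset.mem_insert]; grind
  convert Finset.card_insert_of_notMem (s := ({x ∈ s | dist y x < 2 * r} : Finset E)) (a := a)
    (by simp [ha])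

theorem cnt_insert_neg {E : Type*} [NormedAddCommGroup E] [DecidableEq E] {r : ℝ} {s : Finset E}
    {a y : E} (hy : 2 * r ≤ dist y a) :
    cnt r (insert a s) y = cnt r s y := by
  classical
  unfold cnt
  congr 1
  ext x; simp only [Finset.mem_filter, Finset.mem_insert]; grind

theorem step {E : Type*} [NormedAddCommGroup E] [InnerProductSpace ℝ E] [DecidableEq E]
    {m : ℕ} {r R L α : ℝ} (hL : 0 ≤ L) (hα : 0 < α) (hα1 : α ≤ 1) (hr : 0 < r)
    (hRr : R = 16 * r) {S S' : Set E}
    {T : E → Submodule ℝ E} {F : E → E → E} (hp : ∀ x ∈ S, Patch m R L α S x (T x) (F x))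
    {z a : E} {T' : Submodule ℝ E} {F' : E → E} (hp' : Patch m R L α S' z T' F')
    {t : ℝ} (ht : 0 < t) (ht1 : t ≤ 1)
    (hn : ∀ y ∈ S, ∃ w ∈ S', dist y w ≤ t ^ 2)
    (haS : a ∈ S) (haz : dist a z ≤ t ^ 2) {M Q C2 B : ℝ} (hM : M = 23 + 9 * L)
    (hC2 : C2 = 6 * Q + 16 + 9 * L) (hQ : 1 ≤ Q)
    (hQL : L * (Q * t ^ 2) ^ α ≤ t ^ α) (hB0 : 0 ≤ B) (hB : B * (2 * (Q + 1) * t ^ 2) ≤ t ^ α)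
    (htr : (3 * Q + 8) * t ≤ r)
    {φ : E → ℝ} (hφ : ContDiff ℝ 1 φ) (hφ0 : ∀ y, 0 ≤ φ y) (hφ1 : ∀ y, φ y ≤ 1)
    (hφin : ∀ y, dist y a ≤ r → φ y = 1) (hφout : ∀ y, 2 * r ≤ dist y a → φ y = 0)
    (hφout' : ∀ y, 2 * r ≤ dist y a → fderiv ℝ φ y = 0) (hφB : ∀ y, ‖fderiv ℝ φ y‖ ≤ B)
    {s : Finset E} (has : a ∉ s) (hs : ∀ y, M ^ cnt r s y ≤ Q)
    {J : E → E} (hJ : StepInv r t α M C2 S S' T s J) :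
    ∃ J', StepInv r t α M C2 S S' T (insert a s) J' := by
  have hpa := hp a haS
  have hM1 : 1 ≤ M := by linarith
  have htα : 0 < t ^ α := Real.rpow_pos_of_pos ht α
  have htt : t ^ 2 ≤ t := by nlinarith
  have hQt : Q * t ^ 2 ≤ Q * t := by gcongr
  have hQt0 : 0 ≤ Q * t := by positivity
  set G : E → E := fun y => F' (J (y - F a y)) with hG
  have hGc : ContDiff ℝ 1 G := hp'.cd.comp (hJ.cd.comp (contDiff_id.sub hpa.cd))
  have hMc : ∀ y, 1 ≤ M ^ cnt r s y := fun y => one_le_pow₀ hM1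
  -- core estimate
  have hcore : ∀ y, dist y a < 2 * r → ‖G y‖ ≤ 2 * (M ^ cnt r s (y - F a y) + 1) * t ^ 2 ∧
      ∀ v, ‖fderiv ℝ G y v‖ ≤ 3 * (2 * M ^ cnt r s (y - F a y) + 5 + 3 * L) * t ^ α * ‖v‖ := by
    intro y hy
    have hqS := (hpa.retr_mem (y := y) (by linarith)).1
    refine core (K := y) hL hα hα1 hr hRr hp hp' ht ht1 (by nlinarith) hn haS haz hJ.cd (hMc _) ?_ hy
      (hJ.disp _ hqS) (hJ.tan _ hqS)
    refine le_trans ?_ hQL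
    gcongr
    exact hs _
  have hSfix : ∀ y ∈ S, dist y a < 2 * r → F a y = 0 := fun y hy hya =>
    (hpa.mem y (by linarith)).1 hy
  have hder : ∀ y v, fderiv ℝ (fun y => J y - φ y • G y) y v
      = fderiv ℝ J y v - (φ y • fderiv ℝ G y v + fderiv ℝ φ y v • G y) := by
    intro y v
    have d1 := ((hJ.cd.differentiable (by norm_num)) y).hasFDerivAt
    have d2 := ((hφ.differentiable (by norm_num)) y).hasFDerivAt
    have d3 := ((hGc.differentiable (by norm_num)) y).hasFDerivAt
    have := (d1.sub (d2.smul d3)).fderiv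
    rw [show (fun y => J y - φ y • G y) = J - φ • G from rfl, this]
    simp
  have hφn : ∀ y, ‖φ y‖ ≤ 1 := fun y => by
    rw [Real.norm_of_nonneg (hφ0 y)]; exact hφ1 y
  -- derivative of the correction
  have hcorr : ∀ y, dist y a < 2 * r → ∀ v, ‖φ y • fderiv ℝ G y v + fderiv ℝ φ y v • G y‖
      ≤ 3 * (2 * M ^ cnt r s (y - F a y) + 5 + 3 * L) * t ^ α * ‖v‖ + t ^ α * ‖v‖ := by
    intro y hy v
    obtain ⟨c1, c2⟩ := hcore y hy
    refine (norm_add_le _ _).trans (add_le_add ?_ ?_)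
    · rw [norm_smul]
      calc _ ≤ 1 * ‖fderiv ℝ G y v‖ := by gcongr; exact hφn y
        _ ≤ _ := by rw [one_mul]; exact c2 v
    · rw [norm_smul]
      calc _ ≤ (B * ‖v‖) * (2 * (Q + 1) * t ^ 2) := by
            gcongr
            · exact ((fderiv ℝ φ y).le_opNorm v).trans (by gcongr; exact hφB y)
            · exact c1.trans (by gcongr; exact hs _)
        _ = (B * (2 * (Q + 1) * t ^ 2)) * ‖v‖ := by ring
        _ ≤ _ := by gcongr
  refine ⟨fun y => J y - φ y • G y, hJ.cd.sub (hφ.smul hGc), ?_, ?_, ?_, ?_⟩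
  · intro y hy
    rcases lt_or_ge (dist y a) (2 * r) with hya | hya
    · rw [cnt_insert_pos has hya]
      have hF0 := hSfix y hy hya
      have c1 := (hcore y hya).1
      rw [hF0, sub_zero] at c1
      have e : J y - φ y • G y - y = (J y - y) - φ y • G y := by abel
      rw [e]
      have c2 : ‖φ y • G y‖ ≤ ‖G y‖ := by
        rw [norm_smul]; exact mul_le_of_le_one_left (norm_nonneg _) (hφn y)
      have c3 := hJ.disp y hy
      have c4 : 1 * t ^ 2 ≤ M ^ cnt r s y * t ^ 2 := by gcongr; exact hMc y
      have c5 : M ^ (cnt r s y + 1) * t ^ 2 = M * (M ^ cnt r s y * t ^ 2) := by ring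
      have c6 : 23 * (M ^ cnt r s y * t ^ 2) ≤ M * (M ^ cnt r s y * t ^ 2) := by
        gcongr; linarith
      rw [c5]
      have := norm_sub_le (J y - y) (φ y • G y)
      nlinarith
    · rw [cnt_insert_neg hya, hφout y hya, zero_smul, sub_zero]
      exact hJ.disp y hy
  · intro y hy τ hτ
    rw [hder]
    rcases lt_or_ge (dist y a) (2 * r) with hya | hya
    · rw [cnt_insert_pos has hya]
      have hF0 := hSfix y hy hya
      have c1 := hcorr y hya τ
      rw [hF0, sub_zero] at c1
      have c3 := hJ.tan y hy τ hτ
      have e : fderiv ℝ J y τ - (φ y • fderiv ℝ G y τ + fderiv ℝ φ y τ • G y) - τ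
        = (fderiv ℝ J y τ - τ) - (φ y • fderiv ℝ G y τ + fderiv ℝ φ y τ • G y) := by abel
      rw [e]
      refine (norm_sub_le _ _).trans ?_
      have key : M ^ cnt r s y * t ^ α * ‖τ‖ +
          (3 * (2 * M ^ cnt r s y + 5 + 3 * L) * t ^ α * ‖τ‖ + t ^ α * ‖τ‖)
          = (7 * M ^ cnt r s y + 16 + 9 * L) * (t ^ α * ‖τ‖) := by ring
      have key2 : 7 * M ^ cnt r s y + 16 + 9 * L ≤ M ^ (cnt r s y + 1) := by
        rw [pow_succ, hM]
        rw [← hM]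
        nlinarith [hMc y]
      calc _ ≤ _ := add_le_add c3 c1
        _ = _ := key
        _ ≤ M ^ (cnt r s y + 1) * (t ^ α * ‖τ‖) := by gcongr
        _ = _ := by ring
    · rw [cnt_insert_neg hya, hφout y hya, hφout' y hya]
      simpa using hJ.tan y hy τ hτ
  · rintro y hy ⟨x, hx, hxy⟩
    have hbd : dist y a < 2 * r → dist (J y) z ≤ dist y a + Q * t ^ 2 + t ^ 2 := by
      intro hya
      have c3 := hJ.disp y hy
      rw [← dist_eq_norm] at c3
      have : M ^ cnt r s y * t ^ 2 ≤ Q * t ^ 2 := by gcongr; exact hs y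
      linarith [dist_triangle (J y) y z, dist_triangle y a z]
    by_cases hold : J y ∈ S'
    · rcases lt_or_ge (dist y a) (2 * r) with hya | hya
      · have hF0 := hSfix y hy hya
        have : G y = 0 := by
          simp only [hG, hF0, sub_zero]
          exact (hp'.mem _ (by linarith [hbd hya])).1 hold
        rw [this, smul_zero, sub_zero]; exact hold
      · rw [hφout y hya, zero_smul, sub_zero]; exact hold
    · rcases Finset.mem_insert.1 hx with rfl | hx
      · have hya : dist y x < 2 * r := by linarith
        have hF0 := hSfix y hy hya
        have c1 := (hcore y hya).1
        rw [hφin y hxy, one_smul]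
        simp only [hG, hF0, sub_zero] at c1 ⊢
        apply (hp'.mem _ _).2 (hp'.retr _)
        have c2 : dist (J y - F' (J y)) (J y) = ‖F' (J y)‖ := by simp [dist_eq_norm]
        have c3 : 2 * (M ^ cnt r s y + 1) * t ^ 2 ≤ 2 * (Q + 1) * t ^ 2 := by
          gcongr; exact hs y
        linarith [hbd hya, dist_triangle (J y - F' (J y)) (J y) z]
      · exact absurd (hJ.hit y hy ⟨x, hx, hxy⟩) hold
  · intro y v
    rw [hder]
    rcases lt_or_ge (dist y a) (2 * r) with hya | hya
    · rw [cnt_insert_pos has hya]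
      have c1 := hcorr y hya v
      have c3 := hJ.glob y v
      have e : fderiv ℝ J y v - (φ y • fderiv ℝ G y v + fderiv ℝ φ y v • G y) - v
        = (fderiv ℝ J y v - v) - (φ y • fderiv ℝ G y v + fderiv ℝ φ y v • G y) := by abel
      rw [e]
      refine (norm_sub_le _ _).trans ((add_le_add c3 c1).trans ?_)
      have c4 : 3 * (2 * M ^ cnt r s (y - F a y) + 5 + 3 * L) * t ^ α * ‖v‖
          ≤ 3 * (2 * Q + 5 + 3 * L) * t ^ α * ‖v‖ := by
        gcongr; exact hs _
      rw [hC2]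
      push_cast
      nlinarith
    · rw [cnt_insert_neg hya, hφout y hya, hφout' y hya]
      simpa using hJ.glob y v


theorem cnt_le {E : Type*} [NormedAddCommGroup E] [NormedSpace ℝ E] [FiniteDimensional ℝ E]
    (s X : Finset E) (hsX : s ⊆ X) (r : ℝ) (hr : 0 < r)
    (hX : ∀ x ∈ X, ∀ y ∈ X, x ≠ y → r ≤ dist x y) (y : E) :
    cnt r s y ≤ Besicovitch.multiplicity E := by
  classical
  unfold cnt
  refine card_net _ r hr ?_ y ?_
  · intro x hx z hz hxz
    exact hX x (hsX (Finset.mem_filter.1 hx).1) z (hsX (Finset.mem_filter.1 hz).1) hxz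
  · intro x hx
    exact (Finset.mem_filter.1 hx).2.le

theorem build {E : Type*} [NormedAddCommGroup E] [InnerProductSpace ℝ E] [FiniteDimensional ℝ E]
    {m : ℕ} {r R L α : ℝ} (hL : 0 ≤ L) (hα : 0 < α) (hα1 : α ≤ 1) (hr : 0 < r)
    (hRr : R = 16 * r) {S S' : Set E} (hSc : IsCompact S)
    {T : E → Submodule ℝ E} {F : E → E → E} (hp : ∀ x ∈ S, Patch m R L α S x (T x) (F x))
    {T' : E → Submodule ℝ E} {F' : E → E → E}
    (hp' : ∀ x ∈ S', Patch m R L α S' x (T' x) (F' x))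
    {t : ℝ} (ht : 0 < t) (ht1 : t ≤ 1)
    (hn : ∀ y ∈ S, ∃ w ∈ S', dist y w ≤ t ^ 2)
    {M Q C2 B : ℝ} (hM : M = 23 + 9 * L) (hQM : Q = M ^ Besicovitch.multiplicity E)
    (hC2 : C2 = 6 * Q + 16 + 9 * L)
    (hQL : L * (Q * t ^ 2) ^ α ≤ t ^ α) (hB0 : 0 ≤ B) (hB : B * (2 * (Q + 1) * t ^ 2) ≤ t ^ α)
    (htr : (3 * Q + 8) * t ≤ r)
    (hφ : ∀ a : E, ∃ φ : E → ℝ,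
      ContDiff ℝ 1 φ ∧ (∀ y, 0 ≤ φ y) ∧ (∀ y, φ y ≤ 1) ∧ (∀ y, dist y a ≤ r → φ y = 1) ∧
      (∀ y, 2 * r ≤ dist y a → φ y = 0) ∧ (∀ y, 2 * r ≤ dist y a → fderiv ℝ φ y = 0) ∧
      ∀ y, ‖fderiv ℝ φ y‖ ≤ B) :
    ∃ J : E → E, ContDiff ℝ 1 J ∧ (∀ y ∈ S, ‖J y - y‖ ≤ Q * t ^ 2) ∧ (∀ y ∈ S, J y ∈ S') ∧
      ∀ y v, ‖fderiv ℝ J y v - v‖ ≤ Besicovitch.multiplicity E * (C2 * t ^ α) * ‖v‖ := by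
  classical
  obtain ⟨X, hXS, hXsep, hXnet⟩ := exists_net S hSc r hr
  have hM1 : 1 ≤ M := by linarith
  have hQ : 1 ≤ Q := by rw [hQM]; exact one_le_pow₀ hM1
  have htα : 0 < t ^ α := Real.rpow_pos_of_pos ht α
  have hcQ : ∀ s ⊆ X, ∀ y, M ^ cnt r s y ≤ Q := fun s hs y => by
    rw [hQM]; exact pow_le_pow_right₀ hM1 (cnt_le s X hs r hr hXsep y)
  have key : ∀ s : Finset E, s ⊆ X → ∃ J, StepInv r t α M C2 S S' T s J := by
    intro s
    induction s using Finset.induction_on with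
    | empty =>
      intro _
      refine ⟨fun y => y, contDiff_id, ?_, ?_, ?_, ?_⟩
      · intro y _
        simp only [sub_self, norm_zero]; positivity
      · intro y _ τ _
        simp only [fderiv_fun_id, ContinuousLinearMap.id_apply, sub_self, norm_zero]; positivity
      · rintro y _ ⟨x, hx, _⟩
        simp at hx
      · intro y v
        have : cnt r (∅ : Finset E) y = 0 := by simp [cnt]
        simp [this]
    | insert a s ha ih =>
      intro hs
      have hs' : s ⊆ X := fun x hx => hs (Finset.mem_insert_of_mem hx)
      obtain ⟨J, hJ⟩ := ih hs'
      have haS : a ∈ S := hXS a (hs (Finset.mem_insert_self a s))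
      obtain ⟨z, hz, haz⟩ := hn a haS
      obtain ⟨φ, f1, f2, f3, f4, f5, f6, f7⟩ := hφ a
      exact step hL hα hα1 hr hRr hp (hp' z hz) ht ht1 hn haS haz hM hC2 hQ hQL hB0 hB htr
        f1 f2 f3 f4 f5 f6 f7 ha (hcQ s hs') hJ
  obtain ⟨J, hJ⟩ := key X subset_rfl
  refine ⟨J, hJ.cd, ?_, ?_, ?_⟩
  · intro y hy
    refine (hJ.disp y hy).trans ?_
    gcongr
    exact hcQ X subset_rfl y
  · intro y hy
    exact hJ.hit y hy (hXnet y hy)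
  · intro y v
    refine (hJ.glob y v).trans ?_
    have : 0 ≤ C2 := by rw [hC2]; positivity
    gcongr
    exact cnt_le X X subset_rfl r hr hXsep y

theorem surj {E : Type*} [NormedAddCommGroup E] [InnerProductSpace ℝ E] [FiniteDimensional ℝ E]
    {m : ℕ} {R L α : ℝ} (hR : 0 < R) {S S' : Set E} (hSc : IsCompact S)
    (hSne : S.Nonempty)
    {T : E → Submodule ℝ E} {F : E → E → E} (hp : ∀ x ∈ S, Patch m R L α S x (T x) (F x))
    {T' : E → Submodule ℝ E} {F' : E → E → E}
    (hp' : ∀ x ∈ S', Patch m R L α S' x (T' x) (F' x))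
    {J : E → E} (hJ : ContDiff ℝ 1 J) (hJS : ∀ y ∈ S, J y ∈ S')
    (hinj : ∀ y v, fderiv ℝ J y v = 0 → v = 0)
    {z : E} (hz : z ∈ S') (hnear : ∃ y ∈ S, dist (J y) z < R) : ∃ y ∈ S, J y = z := by
  obtain ⟨y, hy, hmin⟩ := hSc.exists_isMinOn hSne
    (f := fun y => ‖J y - z‖ ^ 2) (by have := hJ.continuous; fun_prop)
  refine ⟨y, hy, ?_⟩
  have hJd : Differentiable ℝ J := hJ.differentiable (by norm_num)
  have hpy := hp y hy
  have hpw := hp' (J y) (hJS y hy)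
  have hFd : Differentiable ℝ (F y) := hpy.cd.differentiable (by norm_num)
  have hFd' : Differentiable ℝ (F' (J y)) := hpw.cd.differentiable (by norm_num)
  have hwz : dist (J y) z < R := by
    obtain ⟨y1, hy1, h1⟩ := hnear
    have h2 : ‖J y - z‖ ^ 2 ≤ ‖J y1 - z‖ ^ 2 := hmin hy1
    rw [dist_eq_norm] at h1 ⊢
    exact lt_of_le_of_lt (by
      exact (pow_le_pow_iff_left₀ (norm_nonneg _) (norm_nonneg _) two_ne_zero).1 h2) h1
  -- the retraction p
  set p : E → E := fun u => u - F y u with hpdef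
  have hp0 : p y = y := by simp [hpdef, hpy.zero]
  have hpder : HasFDerivAt p (ContinuousLinearMap.id ℝ E - fderiv ℝ (F y) y) y :=
    (hasFDerivAt_id y).sub (hFd y).hasFDerivAt
  have hpS : ∀ᶠ u in 𝓝 y, p u ∈ S := by
    have : ∀ᶠ u in 𝓝 y, dist u y < R / 3 := Metric.ball_mem_nhds y (by positivity)
    filter_upwards [this] with u hu
    exact (hpy.retr_mem (y := u) (by linarith)).1
  have hJp : HasFDerivAt (fun u => J (p u))
      (fderiv ℝ J y ∘L (ContinuousLinearMap.id ℝ E - fderiv ℝ (F y) y)) y := by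
    have h1 : HasFDerivAt J (fderiv ℝ J y) (p y) := by rw [hp0]; exact (hJd y).hasFDerivAt
    exact h1.comp y hpder
  have htanT : ∀ τ ∈ T y, (fderiv ℝ J y ∘L (ContinuousLinearMap.id ℝ E - fderiv ℝ (F y) y)) τ
      = fderiv ℝ J y τ := by
    intro τ hτ
    have := (hpy.ker τ).2 hτ
    simp [this]
  -- image of the tangent space
  have himg : ∀ τ ∈ T y, fderiv ℝ J y τ ∈ T' (J y) := by
    intro τ hτ
    rw [← hpw.ker]
    have h1 : HasFDerivAt (F' (J y)) (fderiv ℝ (F' (J y)) (J y)) (J (p y)) := by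
      rw [hp0]; exact (hFd' _).hasFDerivAt
    have h2 := h1.comp y hJp
    have h3 : (F' (J y) ∘ fun u => J (p u)) =ᶠ[𝓝 y] fun _ => 0 := by
      have hc : ContinuousAt (fun u => J (p u)) y := hJp.continuousAt
      have : ∀ᶠ u in 𝓝 y, dist (J (p u)) (J (p y)) < R :=
        hc (Metric.ball_mem_nhds _ hR)
      filter_upwards [this, hpS] with u hu hu'
      rw [hp0] at hu
      exact (hpw.mem _ hu).1 (hJS _ hu')
    have h4 := (h2.congr_of_eventuallyEq h3.symm).unique (hasFDerivAt_const (0:E) y)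
    have h5 := congrArg (fun A : E →L[ℝ] E => A τ) h4
    simp only [ContinuousLinearMap.zero_apply] at h5
    rw [ContinuousLinearMap.comp_apply, htanT τ hτ] at h5
    exact h5
  have hmap : (T y).map (fderiv ℝ J y : E →ₗ[ℝ] E) = T' (J y) := by
    apply Submodule.eq_of_le_of_finrank_eq
    · rintro _ ⟨τ, hτ, rfl⟩
      exact himg τ hτ
    · rw [hpw.rank, ← hpy.rank]
      have hi : Function.Injective (fderiv ℝ J y : E →ₗ[ℝ] E) := by
        rw [injective_iff_map_eq_zero]
        intro v hv
        exact hinj y v hv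
      exact (LinearEquiv.finrank_eq (Submodule.equivMapOfInjective _ hi (T y))).symm
  have horth : ∀ τ ∈ T y, inner ℝ (fderiv ℝ J y τ) (J y - z) = 0 := by
    intro τ hτ
    have hd : HasFDerivAt (fun u => ‖J (p u) - z‖ ^ 2) _ y := (hJp.sub_const z).norm_sq
    have hloc : IsLocalMin (fun u => ‖J (p u) - z‖ ^ 2) y := by
      filter_upwards [hpS] with u hu
      have := hmin hu
      simp only [hp0]
      exact this
    have h0 := hloc.hasFDerivAt_eq_zero hd
    have h5 := congrArg (fun A : E →L[ℝ] ℝ => A τ) h0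
    simp only [hp0] at h5
    have h7 : 2 * inner ℝ (J y - z) ((fderiv ℝ J y ∘L (ContinuousLinearMap.id ℝ E - fderiv ℝ (F y) y)) τ) = 0 := by
      simpa [inner_sub_left, inner_sub_right] using h5
    rw [htanT τ hτ] at h7
    rw [real_inner_comm]
    linarith
  have hzo : z - J y ∈ (T' (J y))ᗮ := by
    rw [Submodule.mem_orthogonal, ← hmap]
    rintro _ ⟨τ, hτ, rfl⟩
    have := horth τ hτ
    rw [← neg_sub (J y) z, inner_neg_right]
    simpa using this
  have h1 := hpw.nor _ hzo
  rw [add_sub_cancel] at h1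
  have h2 := (hpw.mem z (by rwa [dist_comm])).1 hz
  rw [h2] at h1
  exact (sub_eq_zero.1 h1.symm).symm

theorem diffeo {E : Type*} [NormedAddCommGroup E] [InnerProductSpace ℝ E] [FiniteDimensional ℝ E]
    {J : E → E} (hJ : ContDiff ℝ 1 J) {κ : ℝ} (hκ0 : 0 ≤ κ) (hκ : κ ≤ 1 / 2)
    (h : ∀ y v, ‖fderiv ℝ J y v - v‖ ≤ κ * ‖v‖) :
    (∃ Jinv : E → E, ContDiff ℝ 1 Jinv ∧ Function.LeftInverse Jinv J ∧
      Function.RightInverse Jinv J ∧ LipschitzWith (Real.toNNReal (1 + 2 * κ)) J ∧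
      LipschitzWith (Real.toNNReal (1 + 2 * κ)) Jinv) ∧
    ∀ t ∈ Set.Icc (0:ℝ) 1, IsEmbedding fun x => x + (1 - t) • (J x - x) := by
  have hJd : Differentiable ℝ J := hJ.differentiable (by norm_num)
  have hsub : ∀ x y, ‖(J x - x) - (J y - y)‖ ≤ κ * ‖x - y‖ := by
    intro x y
    refine Convex.norm_image_sub_le_of_norm_hasFDerivWithin_le (s := univ) (𝕜 := ℝ)
      (f := fun x => J x - x) (f' := fun x => fderiv ℝ J x - ContinuousLinearMap.id ℝ E)
      (fun x _ => ((hJd x).hasFDerivAt.sub (hasFDerivAt_id x)).hasFDerivWithinAt) ?_ convex_univ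
      (mem_univ _) (mem_univ _)
    intro x _
    exact ContinuousLinearMap.opNorm_le_bound _ hκ0 fun v => h x v
  have hemb : ∀ t ∈ Set.Icc (0:ℝ) 1, ∀ x y,
      ‖x - y‖ ≤ 2 * ‖(x + (1 - t) • (J x - x)) - (y + (1 - t) • (J y - y))‖ := by
    intro t ht x y
    have e : (x + (1 - t) • (J x - x)) - (y + (1 - t) • (J y - y))
      = (x - y) + (1 - t) • ((J x - x) - (J y - y)) := by
      rw [smul_sub (1 - t) (J x - x)]; abel
    have h1 : ‖(1 - t) • ((J x - x) - (J y - y))‖ ≤ 1 * (κ * ‖x - y‖) := by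
      rw [norm_smul, Real.norm_of_nonneg (by linarith [ht.2])]
      gcongr
      · linarith [ht.1]
      · exact hsub x y
    have h2 : κ * ‖x - y‖ ≤ 1 / 2 * ‖x - y‖ := by gcongr
    rw [e]
    have h3 := norm_sub_norm_le (x - y) (-((1 - t) • ((J x - x) - (J y - y))))
    rw [norm_neg, sub_neg_eq_add] at h3
    linarith
  refine ⟨?_, ?_⟩
  · have hlow : ∀ x y, (1 - κ) * ‖x - y‖ ≤ ‖J x - J y‖ := by
      intro x y
      have h3 := norm_sub_norm_le (x - y) (-((J x - x) - (J y - y)))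
      have e : x - y - -((J x - x) - (J y - y)) = J x - J y := by abel
      rw [e, norm_neg] at h3
      linarith [hsub x y]
    have hup : ∀ x y, ‖J x - J y‖ ≤ (1 + κ) * ‖x - y‖ := by
      intro x y
      have h3 := norm_add_le (x - y) (((J x - x) - (J y - y)))
      have e : x - y + ((J x - x) - (J y - y)) = J x - J y := by abel
      rw [e] at h3
      linarith [hsub x y]
    have happ : ApproximatesLinearOn J ((ContinuousLinearEquiv.refl ℝ E : E ≃L[ℝ] E) : E →L[ℝ] E)
        univ (Real.toNNReal κ) := by
      intro x _ y _
      rw [Real.coe_toNNReal κ hκ0]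
      have e : J x - J y - ((ContinuousLinearEquiv.refl ℝ E : E ≃L[ℝ] E) : E →L[ℝ] E) (x - y)
        = (J x - x) - (J y - y) := by simp; abel
      rw [e]
      exact hsub x y
    have hc : Subsingleton E ∨ Real.toNNReal κ
        < ‖((ContinuousLinearEquiv.refl ℝ E : E ≃L[ℝ] E).symm : E →L[ℝ] E)‖₊⁻¹ := by
      rcases subsingleton_or_nontrivial E with hE | hE
      · exact Or.inl hE
      · right
        have : ‖((ContinuousLinearEquiv.refl ℝ E : E ≃L[ℝ] E).symm : E →L[ℝ] E)‖₊ = 1 := by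
          change ‖ContinuousLinearMap.id ℝ E‖₊ = 1
          ext; simp
        rw [this, inv_one, ← NNReal.coe_lt_coe, Real.coe_toNNReal κ hκ0]
        simp; linarith
    let Φ : E ≃ₜ E := happ.toHomeomorph J hc
    have hΦ : ∀ x, Φ x = J x := fun x => rfl
    have hinv : ∀ x, J (Φ.symm x) = x := fun x => Φ.apply_symm_apply x
    refine ⟨Φ.symm, ?_, ?_, ?_, ?_, ?_⟩
    · have hker : ∀ x, Function.Injective (fderiv ℝ J x) := by
        intro x
        rw [injective_iff_map_eq_zero]
        intro v hv
        have := h x v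
        rw [hv, zero_sub, norm_neg] at this
        by_contra hv0
        have := norm_pos_iff.2 hv0
        nlinarith
      let e : E → E ≃L[ℝ] E := fun x =>
        (LinearEquiv.ofInjectiveEndo (fderiv ℝ J x : E →ₗ[ℝ] E) (hker x)).toContinuousLinearEquiv
      refine Φ.contDiff_symm (f₀' := e) (fun a => ?_) hJ
      have : ((e a : E ≃L[ℝ] E) : E →L[ℝ] E) = fderiv ℝ J a := by ext v; rfl
      rw [this]
      exact (hJd a).hasFDerivAt
    · intro x; exact Φ.symm_apply_apply x
    · intro x; exact hinv x
    · refine LipschitzWith.of_dist_le_mul fun x y => ?_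
      rw [Real.coe_toNNReal _ (by linarith), dist_eq_norm, dist_eq_norm]
      refine (hup x y).trans ?_
      gcongr
      linarith
    · refine LipschitzWith.of_dist_le_mul fun x y => ?_
      rw [Real.coe_toNNReal _ (by linarith), dist_eq_norm, dist_eq_norm]
      have := hlow (Φ.symm x) (Φ.symm y)
      rw [hinv, hinv] at this
      have hk : 1 ≤ (1 + 2 * κ) * (1 - κ) := by nlinarith
      calc ‖Φ.symm x - Φ.symm y‖ ≤ ((1 + 2 * κ) * (1 - κ)) * ‖Φ.symm x - Φ.symm y‖ :=
            le_mul_of_one_le_left (norm_nonneg _) hk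
        _ = (1 + 2 * κ) * ((1 - κ) * ‖Φ.symm x - Φ.symm y‖) := by ring
        _ ≤ _ := by gcongr
  · intro t ht
    have ha : AntilipschitzWith 2 fun x => x + (1 - t) • (J x - x) :=
      AntilipschitzWith.of_le_mul_dist fun x y => by
        rw [dist_eq_norm, dist_eq_norm]; exact hemb t ht x y
    refine ha.isEmbedding ?_
    have := hJ.continuous
    fun_prop

theorem fixed_of_small {n m : ℕ} {R L α d : ℝ} (hR : 0 < R) (hL : 0 < L) (hα : 0 < α)
    (hα1 : α ≤ 1) {r M Q C2 B : ℝ} (hr : r = R / 16) (hM : M = 23 + 9 * L)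
    (hQM : Q = M ^ Besicovitch.multiplicity (EuclideanSpace ℝ (Fin n)))
    (hC2 : C2 = 6 * Q + 16 + 9 * L) (hB0 : 0 ≤ B)
    (hφ : ∀ a : EuclideanSpace ℝ (Fin n), ∃ φ : EuclideanSpace ℝ (Fin n) → ℝ,
      ContDiff ℝ 1 φ ∧ (∀ y, 0 ≤ φ y) ∧ (∀ y, φ y ≤ 1) ∧ (∀ y, dist y a ≤ r → φ y = 1) ∧
      (∀ y, 2 * r ≤ dist y a → φ y = 0) ∧ (∀ y, 2 * r ≤ dist y a → fderiv ℝ φ y = 0) ∧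
      ∀ y, ‖fderiv ℝ φ y‖ ≤ B)
    {S S' : Set (EuclideanSpace ℝ (Fin n))} (hS : InClassC1 m n R L d α S)
    (hS' : InClassC1 m n R L d α S') {t : ℝ} (ht : 0 < t) (ht1 : t ≤ 1)
    (hh : Metric.hausdorffDist S S' = t ^ 2)
    (s1 : L * Q * t ^ α ≤ 1) (s2 : B * (2 * (Q + 1)) * t ≤ 1) (s3 : (3 * Q + 8) * t ≤ r)
    (s4 : Besicovitch.multiplicity (EuclideanSpace ℝ (Fin n)) * C2 * t ^ α ≤ 1 / 2) :
    ∃ J : EuclideanSpace ℝ (Fin n) → EuclideanSpace ℝ (Fin n), ContDiff ℝ 1 J ∧ J '' S = S' ∧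
      ∀ y v, ‖fderiv ℝ J y v - v‖ ≤
        (Besicovitch.multiplicity (EuclideanSpace ℝ (Fin n)) * C2 * t ^ α) * ‖v‖ := by
  have hM1 : 1 ≤ M := by linarith
  have hQ : 1 ≤ Q := by rw [hQM]; exact one_le_pow₀ hM1
  have htα : 0 < t ^ α := Real.rpow_pos_of_pos ht α
  have htt : t ^ 2 ≤ t := by nlinarith
  have htle : t ≤ t ^ α := by
    have := Real.rpow_le_rpow_of_exponent_ge ht ht1 hα1
    rwa [Real.rpow_one] at this
  have hr0 : 0 < r := by rw [hr]; positivity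
  have mk : ∀ A : Set (EuclideanSpace ℝ (Fin n)), InClassC1 m n R L d α A →
      ∃ (T : EuclideanSpace ℝ (Fin n) → Submodule ℝ (EuclideanSpace ℝ (Fin n)))
        (F : EuclideanSpace ℝ (Fin n) → EuclideanSpace ℝ (Fin n) → EuclideanSpace ℝ (Fin n)),
        ∀ x ∈ A, Patch m R L α A x (T x) (F x) := by
    intro A hA
    have : ∀ x, ∃ (T : Submodule ℝ (EuclideanSpace ℝ (Fin n)))
        (F : EuclideanSpace ℝ (Fin n) → EuclideanSpace ℝ (Fin n)),
        x ∈ A → Patch m R L α A x T F := by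
      intro x
      by_cases hx : x ∈ A
      · obtain ⟨T, hT, f, f1, f2, f3, f4, f5, f6⟩ := hA.2.2.2 x hx
        obtain ⟨F, hF⟩ := patch_exists m R L α hL.le hα.le A x T hT f f1 f2 f3 f4 f5 f6
        exact ⟨T, F, fun _ => hF⟩
      · exact ⟨⊥, fun y => y, fun h => absurd h hx⟩
    choose T F hTF using this
    exact ⟨T, F, hTF⟩
  obtain ⟨T, F, hp⟩ := mk S hS
  obtain ⟨T', F', hp'⟩ := mk S' hS'
  have near : ∀ A A' : Set (EuclideanSpace ℝ (Fin n)), InClassC1 m n R L d α A →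
      InClassC1 m n R L d α A' → Metric.hausdorffDist A A' = t ^ 2 →
      ∀ y ∈ A, ∃ w ∈ A', dist y w ≤ t ^ 2 := by
    intro A A' hA hA' hd y hy
    obtain ⟨w, hw, hyw⟩ := hA'.2.1.exists_infDist_eq_dist hA'.1 y
    refine ⟨w, hw, ?_⟩
    rw [← hyw, ← hd]
    exact Metric.infDist_le_hausdorffDist_of_mem hy
      (Metric.hausdorffEDist_ne_top_of_nonempty_of_bounded hA.1 hA'.1 hA.2.1.isBounded
        hA'.2.1.isBounded)
  have hn := near S S' hS hS' hh
  have hn' := near S' S hS' hS (by rw [Metric.hausdorffDist_comm]; exact hh)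
  have hQL : L * (Q * t ^ 2) ^ α ≤ t ^ α := by
    have e : (Q * t ^ 2) ^ α = Q ^ α * (t ^ α * t ^ α) := by
      rw [Real.mul_rpow (by linarith) (by positivity), pow_two, Real.mul_rpow ht.le ht.le]
    have e2 : Q ^ α ≤ Q := by
      have := Real.rpow_le_rpow_of_exponent_le hQ hα1
      rwa [Real.rpow_one] at this
    rw [e]
    calc L * (Q ^ α * (t ^ α * t ^ α)) ≤ L * (Q * (t ^ α * t ^ α)) := by gcongr
      _ = (L * Q * t ^ α) * t ^ α := by ring
      _ ≤ 1 * t ^ α := by gcongr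
      _ = _ := one_mul _
  have hBt : B * (2 * (Q + 1) * t ^ 2) ≤ t ^ α := by
    calc B * (2 * (Q + 1) * t ^ 2) = (B * (2 * (Q + 1)) * t) * t := by ring
      _ ≤ 1 * t := by gcongr
      _ ≤ _ := by linarith
  obtain ⟨J, hJ, hdisp, hJS, hglob⟩ := build hL.le hα hα1 hr0 (by rw [hr]; ring) hS.2.1 hp hp'
    ht ht1 hn hM hQM hC2 hQL hB0 hBt s3 hφ
  have hglob2 : ∀ y v, ‖fderiv ℝ J y v - v‖ ≤
      (Besicovitch.multiplicity (EuclideanSpace ℝ (Fin n)) * C2 * t ^ α) * ‖v‖ := by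
    intro y v
    have := hglob y v
    rwa [← mul_assoc] at this
  refine ⟨J, hJ, ?_, hglob2⟩
  apply Subset.antisymm
  · rintro _ ⟨y, hy, rfl⟩
    exact hJS y hy
  · intro z hz
    refine surj hR hS.2.1 hS.1 hp hp' hJ hJS ?_ hz ?_
    · intro y v hv
      have h1 := hglob2 y v
      rw [hv, zero_sub, norm_neg] at h1
      by_contra hv0
      have := norm_pos_iff.2 hv0
      nlinarith
    · obtain ⟨y, hy, h1⟩ := hn' z hz
      refine ⟨y, hy, ?_⟩
      have h2 := hdisp y hy
      rw [← dist_eq_norm] at h2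
      rw [dist_comm] at h1
      have h3 : Q * t ^ 2 ≤ Q * t := by gcongr
      have h4 : 0 ≤ Q * t := by positivity
      have h5 : R = 16 * r := by rw [hr]; ring
      linarith [dist_triangle (J y) y z]

/-- **Isotopy and diffeomorphism of the ambient space** (Theorem 5): if a sequence in
`C^{1,α}_{m,n}(R,L,d)` converges in the `C^{1,α}` graph-patch sense to `S₀` in the same
class, then for all large `j` the sets `Σ_j` and `S₀` are ambient isotopic, and there is a
`C¹` diffeomorphism `J_j` of `ℝⁿ` with `J_j(Σ_j) = S₀` and
`bilip(J_j) ≤ 1 + C_J d_H(S₀,Σ_j)^{α/2}`, where `C_J` depends only on `R, L, α, m, n`. -/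
theorem isotopy_and_ambient_diffeo_of_graph_patch_convergence (m n : ℕ) (R L α : ℝ)
    (hm : 1 ≤ m) (hmn : m < n) (hR : 0 < R) (hL : 0 < L) (hα : 0 < α) (hα1 : α ≤ 1) :
    ∃ C_J : ℝ, 0 < C_J ∧ ∀ d : ℝ, 0 < d →
      ∀ (Ss : ℕ → Set (EuclideanSpace ℝ (Fin n))) (S₀ : Set (EuclideanSpace ℝ (Fin n))),
        (∀ j, InClassC1 m n R L d α (Ss j)) → InClassC1 m n R L d α S₀ →
        GraphPatchConverges m n α Ss S₀ →
        ∃ j₀ : ℕ, ∀ j, j₀ ≤ j →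
          AmbientIsotopic n (Ss j) S₀ ∧
          ∃ J Jinv : EuclideanSpace ℝ (Fin n) → EuclideanSpace ℝ (Fin n),
            IsC1DiffeoWithInv J Jinv ∧ J '' Ss j = S₀ ∧
            LipschitzWith
              (Real.toNNReal (1 + C_J * Metric.hausdorffDist S₀ (Ss j) ^ (α / 2))) J ∧
            LipschitzWith
              (Real.toNNReal (1 + C_J * Metric.hausdorffDist S₀ (Ss j) ^ (α / 2))) Jinv := by
  obtain ⟨B, hB0, hφ⟩ := exists_bump (EuclideanSpace ℝ (Fin n)) (R / 16) (by positivity)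
  set N : ℝ := ((Besicovitch.multiplicity (EuclideanSpace ℝ (Fin n)) : ℕ) : ℝ) with hN
  obtain ⟨M, hM⟩ : ∃ M : ℝ, M = 23 + 9 * L := ⟨_, rfl⟩
  obtain ⟨Q, hQM⟩ : ∃ Q : ℝ, Q = M ^ Besicovitch.multiplicity (EuclideanSpace ℝ (Fin n)) :=
    ⟨_, rfl⟩
  obtain ⟨C2, hC2⟩ : ∃ C2 : ℝ, C2 = 6 * Q + 16 + 9 * L := ⟨_, rfl⟩
  have hN0 : 0 ≤ N := by rw [hN]; positivity
  have hQ0 : 0 ≤ Q := by rw [hQM, hM]; positivity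
  have hC20 : 0 ≤ C2 := by rw [hC2]; positivity
  refine ⟨2 * (N * C2) + 1, by positivity, ?_⟩
  intro d hd Ss S₀ hSs hS₀ hconv
  have hlim := hconv.1
  have hlt : Filter.Tendsto (fun j => Real.sqrt (Metric.hausdorffDist (Ss j) S₀))
      Filter.atTop (nhds 0) := by
    have := (Real.continuous_sqrt.tendsto 0).comp hlim
    rwa [Real.sqrt_zero] at this
  have hlα : Filter.Tendsto (fun j => Real.sqrt (Metric.hausdorffDist (Ss j) S₀) ^ α)
      Filter.atTop (nhds 0) := by
    have := hlt.rpow_const (p := α) (Or.inr hα.le)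
    rwa [Real.zero_rpow hα.ne'] at this
  have small : ∀ (u : ℕ → ℝ), Filter.Tendsto u Filter.atTop (nhds 0) → ∀ c ε : ℝ, 0 < ε →
      ∀ᶠ j in Filter.atTop, c * u j ≤ ε := by
    intro u hu c ε hε
    have h1 := hu.const_mul c
    rw [mul_zero] at h1
    exact (h1.eventually_lt_const hε).mono fun j hj => hj.le
  have hev := ((((small _ hlt 1 1 one_pos).and (small _ hlα (L * Q) 1 one_pos)).and
    (small _ hlt (B * (2 * (Q + 1))) 1 one_pos)).and
    (small _ hlt (3 * Q + 8) (R / 16) (by positivity))).and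
    (small _ hlα (N * C2) (1 / 2) (by norm_num))
  obtain ⟨j₀, hj₀⟩ := Filter.eventually_atTop.1 hev
  refine ⟨j₀, fun j hj => ?_⟩
  obtain ⟨⟨⟨⟨s0, s1⟩, s2⟩, s3⟩, s4⟩ := hj₀ j hj
  rw [Metric.hausdorffDist_comm] at s0 s1 s2 s3 s4
  have hh0 : 0 ≤ Metric.hausdorffDist S₀ (Ss j) := Metric.hausdorffDist_nonneg
  set h := Metric.hausdorffDist S₀ (Ss j) with hh
  have hαpow : Real.sqrt h ^ α = h ^ (α / 2) := by
    rw [Real.sqrt_eq_rpow, ← Real.rpow_mul hh0]; congr 1; ring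
  have hpow0 : 0 ≤ h ^ (α / 2) := Real.rpow_nonneg hh0 _
  have hcl : ∀ A, InClassC1 m n R L d α A → IsClosed A := fun A hA => hA.2.1.isClosed
  obtain ⟨J, hJ, hJi, hglob⟩ : ∃ J : EuclideanSpace ℝ (Fin n) → EuclideanSpace ℝ (Fin n),
      ContDiff ℝ 1 J ∧ J '' S₀ = Ss j ∧
      ∀ y v, ‖fderiv ℝ J y v - v‖ ≤ (N * C2 * h ^ (α / 2)) * ‖v‖ := by
    rcases hh0.eq_or_lt with h0 | hpos
    · refine ⟨fun y => y, contDiff_id, ?_, ?_⟩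
      · have : S₀ = Ss j := by
          refine (IsClosed.hausdorffDist_zero_iff_eq (hcl _ hS₀) (hcl _ (hSs j)) ?_).1 h0.symm
          exact Metric.hausdorffEDist_ne_top_of_nonempty_of_bounded hS₀.1 (hSs j).1
            hS₀.2.1.isBounded (hSs j).2.1.isBounded
        simp [this]
      · intro y v
        simp only [fderiv_fun_id, ContinuousLinearMap.id_apply, sub_self, norm_zero]
        positivity
    · rw [← hαpow]
      exact fixed_of_small hR hL hα hα1 rfl hM hQM hC2 hB0 hφ hS₀ (hSs j)
        (Real.sqrt_pos.2 hpos) (by linarith) (Real.sq_sqrt hh0).symm s1 s2 s3 s4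
  rw [hαpow] at s4
  obtain ⟨⟨Jinv, i1, i2, i3, i4, i5⟩, hemb⟩ := diffeo hJ (κ := N * C2 * h ^ (α / 2))
    (by positivity) s4 hglob
  have hle : Real.toNNReal (1 + 2 * (N * C2 * h ^ (α / 2)))
      ≤ Real.toNNReal (1 + (2 * (N * C2) + 1) * h ^ (α / 2)) := by
    apply Real.toNNReal_le_toNNReal
    nlinarith
  refine ⟨⟨fun p => p.1 + (1 - p.2) • (J p.1 - p.1), ?_, hemb, ?_, ?_⟩, Jinv, J,
    ⟨i1, hJ, i3, i2⟩, ?_, i5.weaken hle, i4.weaken hle⟩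
  · have := hJ.continuous
    fun_prop
  · intro x; simp
  · simpa using hJi
  · rw [← hJi, ← Set.image_comp]
    have : Jinv ∘ J = id := funext i2
    rw [this, Set.image_id]
end
end

section
/- Fix integers 1 ≤ m < n, constants R, L, d > 0 and α ∈ (0,1]. Then there exists ρ > 0 depending only on R, L, α, m, n such that any two sets Σ₁, Σ₂ ∈ C^{1,α}_{m,n}(R,L,d) with d_H(Σ₁,Σ₂) ≤ ρ are ambient isotopic. -/
open Set Metric MeasureTheory Filter Topology
open scoped ENNReal NNReal

noncomputable section

section Aux

variable {E : Type*} [NormedAddCommGroup E] [InnerProductSpace ℝ E]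

structure GPatch (R lam s : ℝ) (S : Set E) (c : E) (P : E →L[ℝ] E) (F : E → E) : Prop where
  P_le : ∀ z, ‖P z‖ ≤ ‖z‖
  Q_le : ∀ z, ‖z - P z‖ ≤ ‖z‖
  PP : ∀ z, P (P z) = P z
  PF : ∀ z, P (F z) = 0
  FP : ∀ z, F (P z) = F z
  F_zero : F 0 = 0
  F_lip : ∀ z w, ‖F z - F w‖ ≤ ‖z - w‖
  F_small : ∀ z w, ‖z‖ ≤ 8 * s → ‖w‖ ≤ 8 * s → ‖F z - F w‖ ≤ lam * ‖z - w‖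
  mem : ∀ z ∈ S, ‖z - c‖ < R → F (z - c) = (z - c) - P (z - c)
  mem' : ∀ z, ‖P z + F z‖ < R → c + P z + F z ∈ S

theorem GPatch.exists {n : ℕ} {m : ℕ} {R L α s : ℝ} (hL : 0 < L) (hα : 0 < α) (hs : 0 < s)
    {S : Set (EuclideanSpace ℝ (Fin n))} {x : EuclideanSpace ℝ (Fin n)}
    {T : Submodule ℝ (EuclideanSpace ℝ (Fin n))} (h : IsGraphPatchAt m n R L α S x T) :
    ∃ P F, GPatch R (L * (8 * s) ^ α) s S x P F := by
  obtain ⟨-, f, hf, f0, df0, flip, fh, hS⟩ := h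
  have key : ∀ z : EuclideanSpace ℝ (Fin n), T.orthogonalProjectionOnto (T.starProjection z)
      = T.orthogonalProjectionOnto z := by
    intro z
    rw [Submodule.starProjection_apply, Submodule.orthogonalProjectionOnto_mem_subspace_eq_self]
  have hQ : ∀ z : EuclideanSpace ℝ (Fin n), ‖z - T.starProjection z‖ ≤ ‖z‖ := by
    intro z
    rw [← Submodule.starProjection_orthogonal_val]
    exact Submodule.norm_starProjection_apply_le _ _
  have hpd : ∀ z w : EuclideanSpace ℝ (Fin n), ‖T.orthogonalProjectionOnto z -
      T.orthogonalProjectionOnto w‖ ≤ ‖z - w‖ := by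
    intro z w
    rw [← map_sub]
    exact Submodule.norm_orthogonalProjectionOnto_apply_le _ _
  refine ⟨T.starProjection, fun z => (f (T.orthogonalProjectionOnto z) : _), ?_, hQ, ?_, ?_, ?_,
    ?_, ?_, ?_, ?_, ?_⟩
  · exact fun z => Submodule.norm_starProjection_apply_le _ _
  · intro z
    rw [Submodule.starProjection_eq_self_iff]
    exact Submodule.starProjection_apply_mem _ _
  · intro z
    rw [Submodule.starProjection_apply_eq_zero_iff]
    exact (f _).2
  · intro z
    simp only [key]
  · simp [f0]
  · intro z w
    have := flip.dist_le_mul (T.orthogonalProjectionOnto z) (T.orthogonalProjectionOnto w)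
    rw [dist_eq_norm, dist_eq_norm] at this
    have h2 := hpd z w
    rw [← Submodule.coe_sub, ← Submodule.coe_norm]
    simp only [NNReal.coe_one, one_mul] at this
    linarith
  · intro z w hz hw
    have hz' := (Submodule.norm_orthogonalProjectionOnto_apply_le T z).trans hz
    have hw' := (Submodule.norm_orthogonalProjectionOnto_apply_le T w).trans hw
    have := Convex.norm_image_sub_le_of_norm_fderiv_le (𝕜 := ℝ) (f := f)
      (s := Metric.closedBall 0 (8 * s)) (C := L * (8 * s) ^ α)
      (x := T.orthogonalProjectionOnto w) (y := T.orthogonalProjectionOnto z)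
      (fun x _ => (hf.differentiable (by norm_num)) x) ?_ (convex_closedBall _ _)
      (by simpa using hw') (by simpa using hz')
    · rw [← Submodule.coe_sub, ← Submodule.coe_norm]
      refine this.trans ?_
      have := hpd z w
      gcongr
    · intro u hu
      have h1 := fh u 0
      rw [df0, sub_zero, sub_zero] at h1
      refine h1.trans ?_
      have : ‖u‖ ≤ 8 * s := by simpa using hu
      gcongr
  · intro z hz hzR
    have : z ∈ S ∩ Metric.ball x R := ⟨hz, by rwa [Metric.mem_ball, dist_eq_norm]⟩
    rw [hS] at this
    obtain ⟨⟨ξ, rfl⟩, -⟩ := this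
    have e1 : x + (ξ : EuclideanSpace ℝ (Fin n)) + (f ξ : EuclideanSpace ℝ (Fin n)) - x
        = ξ + f ξ := by abel
    have e2 : T.orthogonalProjectionOnto ((ξ : EuclideanSpace ℝ (Fin n)) + f ξ) = ξ := by
      rw [map_add, Submodule.orthogonalProjectionOnto_mem_subspace_eq_self,
        Submodule.orthogonalProjectionOnto_apply_of_mem_orthogonal (f ξ).2, add_zero]
    simp only [e1, Submodule.starProjection_apply, e2]
    abel
  · intro z hz
    have : x + T.starProjection z + f (T.orthogonalProjectionOnto z) ∈ S ∩ Metric.ball x R := by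
      rw [hS]
      refine ⟨⟨T.orthogonalProjectionOnto z, ?_⟩, ?_⟩
      · rw [Submodule.starProjection_apply]
      · rw [Metric.mem_ball, dist_eq_norm]
        rw [add_assoc, add_sub_cancel_left]
        exact hz
    exact this.1

theorem GPatch.tilt {R lam s ρ : ℝ} {S S' : Set E} {x z z' : E} {P P' : E →L[ℝ] E} {F F' : E → E}
    (h : GPatch R lam s S x P F) (h' : GPatch R lam s S' z P' F') (hs : 0 < s) (hR : 16 * s ≤ R)
    (hlam : 0 ≤ lam) (hρ : 0 < ρ) (hρs : 2 * ρ ≤ s) (hd : ∀ y ∈ S', ∃ p ∈ S, ‖y - p‖ ≤ ρ)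
    (hz : z ∈ S') (hz' : z' ∈ S') (hzx : ‖z - x‖ ≤ 2 * s) (hzx' : ‖z' - x‖ ≤ 2 * s) :
    ‖(z' - z) - P (z' - z)‖ ≤ (2 * ρ / s + 5 * lam) * ‖z' - z‖ := by
  have hzz : ‖z' - z‖ ≤ 4 * s := by
    have := norm_sub_le (z' - x) (z - x)
    rw [sub_sub_sub_cancel_right] at this
    linarith
  have hm := h'.mem z' hz' (by linarith)
  set ξ := P' (z' - z) with hξ
  have hξle : ‖ξ‖ ≤ ‖z' - z‖ := h'.P_le _
  have hzξ : z' - z = ξ + F' ξ := by rw [hξ, h'.FP, hm]; abel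
  by_cases hξ0 : ξ = 0
  · have : z' - z = 0 := by rw [hzξ, hξ0, h'.F_zero]; simp
    simp [this]
  have hξpos : 0 < ‖ξ‖ := norm_pos_iff.mpr hξ0
  set u : E := (s / ‖ξ‖) • ξ with hu
  have hun : ‖u‖ = s := by
    rw [hu, norm_smul, Real.norm_of_nonneg (by positivity)]
    field_simp
  have hPu : P' u = u := by rw [hu, map_smul, hξ, h'.PP]
  have hFu : ‖F' u‖ ≤ lam * s := by
    have := h'.F_small u 0 (by linarith) (by simp; linarith)
    rwa [h'.F_zero, sub_zero, sub_zero, hun] at this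
  have hFu1 : ‖F' u‖ ≤ s := by
    have := h'.F_lip u 0
    rwa [h'.F_zero, sub_zero, sub_zero, hun] at this
  have hw := h'.mem' u (by rw [hPu]; have := norm_add_le u (F' u); linarith)
  rw [hPu] at hw
  obtain ⟨p, hp, hzp⟩ := hd z hz
  obtain ⟨q, hq, hwq⟩ := hd _ hw
  set w := z + u + F' u with hwdef
  have hpx : ‖p - x‖ ≤ 3 * s := by
    have := norm_sub_le (z - x) (z - p)
    rw [sub_sub_sub_cancel_left] at this
    linarith
  have hqx : ‖q - x‖ ≤ 5 * s := by
    have e : q - x = (z - x) + u + F' u - (w - q) := by rw [hwdef]; abel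
    have h1 := norm_sub_le ((z - x) + u + F' u) (w - q)
    have h2 := norm_add₃_le (a := z - x) (b := u) (c := F' u)
    rw [e]; linarith
  have hqp : ‖q - p‖ ≤ 3 * s + lam * s := by
    have e : q - p = u + F' u + (z - p) - (w - q) := by rw [hwdef]; abel
    have h1 := norm_sub_le (u + F' u + (z - p)) (w - q)
    have h2 := norm_add₃_le (a := u) (b := F' u) (c := z - p)
    rw [e]; linarith
  have hqp' : ‖q - p‖ ≤ 3 * s := by
    have e : q - p = u + F' u + (z - p) - (w - q) := by rw [hwdef]; abel
    have h1 := norm_sub_le (u + F' u + (z - p)) (w - q)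
    have h2 := norm_add₃_le (a := u) (b := F' u) (c := z - p)
    rw [e]; linarith
  have hQ : ‖(q - p) - P (q - p)‖ ≤ lam * (3 * s) := by
    have h1 := h.mem p hp (by linarith)
    have h2 := h.mem q hq (by linarith)
    have h3 := h.F_small (q - x) (p - x) (by linarith) (by linarith)
    rw [h1, h2, sub_sub_sub_cancel_right] at h3
    have e : (q - p) - P (q - p) = (q - x - P (q - x)) - (p - x - P (p - x)) := by
      rw [show q - p = (q - x) - (p - x) by abel, map_sub]; abel
    rw [e]
    exact h3.trans (by gcongr)
  have hQu : ‖u - P u‖ ≤ 2 * ρ + 4 * lam * s := by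
    have e : u - P u = ((w - q) - P (w - q)) + ((q - p) - P (q - p)) - ((z - p) - P (z - p))
        - (F' u - P (F' u)) := by
      have : u = (w - q) + (q - p) - (z - p) - F' u := by rw [hwdef]; abel
      conv_lhs => rw [this]
      simp only [map_add, map_sub]; abel
    have h1 := h.Q_le (w - q)
    have h2 := h.Q_le (z - p)
    have h3 := h.Q_le (F' u)
    rw [e]
    have n1 := norm_sub_le (((w - q) - P (w - q)) + ((q - p) - P (q - p)) - ((z - p) - P (z - p)))
      (F' u - P (F' u))
    have n2 := norm_sub_le (((w - q) - P (w - q)) + ((q - p) - P (q - p))) ((z - p) - P (z - p))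
    have n3 := norm_add_le ((w - q) - P (w - q)) ((q - p) - P (q - p))
    linarith
  have hξu : ξ = (‖ξ‖ / s) • u := by
    rw [hu, smul_smul]
    field_simp
    simp
  have hQξ : ‖ξ - P ξ‖ ≤ (2 * ρ / s + 4 * lam) * ‖ξ‖ := by
    have : ξ - P ξ = (‖ξ‖ / s) • (u - P u) := by
      conv_lhs => rw [hξu]
      rw [map_smul, smul_sub]
    rw [this, norm_smul, Real.norm_of_nonneg (by positivity)]
    calc ‖ξ‖ / s * ‖u - P u‖ ≤ ‖ξ‖ / s * (2 * ρ + 4 * lam * s) := by gcongr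
      _ = _ := by field_simp
  have hFξ : ‖F' ξ‖ ≤ lam * ‖ξ‖ := by
    have := h'.F_small ξ 0 (by linarith) (by simp; linarith)
    rwa [h'.F_zero, sub_zero, sub_zero] at this
  have e : (z' - z) - P (z' - z) = (ξ - P ξ) + (F' ξ - P (F' ξ)) := by
    rw [hzξ, map_add]; abel
  rw [e]
  have h1 := h.Q_le (F' ξ)
  have h2 := norm_add_le (ξ - P ξ) (F' ξ - P (F' ξ))
  calc _ ≤ (2 * ρ / s + 5 * lam) * ‖ξ‖ := by linarith
    _ ≤ _ := by gcongr

theorem bump_lip (s t t' : ℝ) (hs : 0 < s) :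
    |max 0 (min 1 (7/2 - 2 * t / s)) - max 0 (min 1 (7/2 - 2 * t' / s))| ≤ 2 / s * |t - t'| := by
  have h1 := abs_max_sub_max_le_abs (min 1 (7/2 - 2 * t / s)) (min 1 (7/2 - 2 * t' / s)) 0
  have h2 := abs_min_sub_min_le_max 1 (7/2 - 2 * t / s) 1 (7/2 - 2 * t' / s)
  have h3 : |(7/2 - 2 * t / s) - (7/2 - 2 * t' / s)| = 2 / s * |t - t'| := by
    rw [show (7/2 - 2 * t / s) - (7/2 - 2 * t' / s) = - (2 / s * (t - t')) by ring, abs_neg,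
      abs_mul, abs_of_pos (by positivity)]
  rw [h3, sub_self, abs_zero, max_eq_right (by positivity)] at h2
  rw [max_comm 0, max_comm 0]
  linarith

theorem GPatch.step {R lam s : ℝ} {S : Set E} {c : E} {P : E →L[ℝ] E} {F : E → E}
    (h : GPatch R lam s S c P F) (hs : 0 < s) (hR : 16 * s ≤ R) (hlam : 0 ≤ lam) :
    ∃ Φ : E → E,
      (∀ z, 7 / 4 * s ≤ ‖z - c‖ → Φ z = z) ∧
      (∀ z, ∀ p ∈ S, ‖z - p‖ ≤ s → ‖Φ z - z‖ ≤ 2 * ‖z - p‖) ∧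
      (∀ z ∈ S, Φ z = z) ∧
      (∀ z, ∀ p ∈ S, ‖z - c‖ ≤ 5 / 4 * s → ‖z - p‖ ≤ s / 8 → Φ z ∈ S) ∧
      (∀ z z', ∀ p ∈ S, ∀ p' ∈ S, ∀ D β : ℝ, D ≤ s / 8 → 0 ≤ β → ‖z - p‖ ≤ D → ‖z' - p'‖ ≤ D →
        (‖z - c‖ < 7 / 4 * s → ‖z' - c‖ < 7 / 4 * s → ‖(z - z') - P (z - z')‖ ≤ β) →
        ‖(Φ z - z) - (Φ z' - z')‖ ≤ (4 * D / s + lam) * ‖z - z'‖ + β) := by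
  set g : E → E := fun z => F (z - c) - ((z - c) - P (z - c)) with hg
  set χ : E → ℝ := fun z => max 0 (min 1 (7/2 - 2 * ‖z - c‖ / s)) with hχ
  have χ0 : ∀ z, 0 ≤ χ z := fun z => le_max_left _ _
  have χ1 : ∀ z, χ z ≤ 1 := fun z => max_le (by norm_num) (min_le_left _ _)
  have χout : ∀ z, 7 / 4 * s ≤ ‖z - c‖ → χ z = 0 := by
    intro z hz
    refine max_eq_left ((min_le_right _ _).trans ?_)
    rw [sub_nonpos, le_div_iff₀ hs]; linarith
  have χin : ∀ z, ‖z - c‖ ≤ 5 / 4 * s → χ z = 1 := by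
    intro z hz
    have : (1 : ℝ) ≤ 7/2 - 2 * ‖z - c‖ / s := by
      rw [le_sub_comm, div_le_iff₀ hs]; linarith
    simp only [hχ]
    rw [min_eq_left this]; norm_num
  have χlip : ∀ z z', |χ z - χ z'| ≤ 2 / s * ‖z - z'‖ := by
    intro z z'
    refine (bump_lip s _ _ hs).trans ?_
    have := abs_norm_sub_norm_le (z - c) (z' - c)
    rw [sub_sub_sub_cancel_right] at this
    gcongr
  have gdiff : ∀ z w, g z - g w = (F (z - c) - F (w - c)) - ((z - w) - P (z - w)) := by
    intro z w
    simp only [hg]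
    simp only [map_sub]; abel
  have g2 : ∀ z w, ‖g z - g w‖ ≤ 2 * ‖z - w‖ := by
    intro z w
    rw [gdiff]
    have h1 := h.F_lip (z - c) (w - c)
    have h2 := h.Q_le (z - w)
    have h3 := norm_sub_le (F (z - c) - F (w - c)) ((z - w) - P (z - w))
    rw [sub_sub_sub_cancel_right] at h1
    linarith
  have g0 : ∀ z ∈ S, ‖z - c‖ < R → g z = 0 := by
    intro z hz hzc
    simp only [hg]
    rw [h.mem z hz hzc, sub_self]
  have gle : ∀ z, ∀ p ∈ S, ‖z - c‖ < 7 / 4 * s → ‖z - p‖ ≤ s → ‖g z‖ ≤ 2 * ‖z - p‖ := by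
    intro z p hp hz hzp
    have h1 := norm_sub_le (z - c) (z - p)
    rw [sub_sub_sub_cancel_left] at h1
    have := g2 z p
    rwa [g0 p hp (by linarith), sub_zero] at this
  have ediff : ∀ z, (z + χ z • g z) - z = χ z • g z := fun z => by abel
  refine ⟨fun z => z + χ z • g z, ?_, ?_, ?_, ?_, ?_⟩
  · intro z hz
    simp [χout z hz]
  · intro z p hp hzp
    simp only [ediff]
    by_cases hz : ‖z - c‖ < 7 / 4 * s
    · rw [norm_smul, Real.norm_of_nonneg (χ0 z)]
      have h1 := gle z p hp hz hzp
      have h2 := mul_le_of_le_one_left (norm_nonneg (g z)) (χ1 z)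
      linarith
    · rw [χout z (not_lt.mp hz)]; simp
  · intro z hz
    by_cases hzc : ‖z - c‖ < 7 / 4 * s
    · simp [g0 z hz (by linarith)]
    · simp [χout z (not_lt.mp hzc)]
  · intro z p hp hz hzp
    have h1 := gle z p hp (by linarith) (by linarith)
    have e : P (z - c) + F (z - c) = (z - c) + g z := by simp only [hg]; abel
    have := h.mem' (z - c) (by
      rw [e]; have := norm_add_le (z - c) (g z); linarith)
    rw [add_assoc, e] at this
    simp only [χin z hz, one_smul]
    convert this using 1; abel
  · intro z z' p hp p' hp' D β hD hβ hzp hzp' hQ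
    have hD0 : 0 ≤ D := (norm_nonneg _).trans hzp
    simp only [ediff]
    have rhs0 : 0 ≤ (4 * D / s + lam) * ‖z - z'‖ := by positivity
    have hl : 0 ≤ lam * ‖z - z'‖ := by positivity
    have e1 : χ z • g z - χ z' • g z' = (χ z - χ z') • g z + χ z' • (g z - g z') := by
      generalize g z = u; generalize g z' = v; module
    have e2 : χ z • g z - χ z' • g z' = (χ z - χ z') • g z' + χ z • (g z - g z') := by
      generalize g z = u; generalize g z' = v; module
    have hA : ∀ w, ‖g w‖ ≤ 2 * D → ‖(χ z - χ z') • g w‖ ≤ 4 * D / s * ‖z - z'‖ := by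
      intro w hw
      rw [norm_smul, Real.norm_eq_abs]
      calc _ ≤ (2 / s * ‖z - z'‖) * (2 * D) := by
            gcongr
            exact χlip z z'
        _ = _ := by ring
    by_cases hz : ‖z - c‖ < 7 / 4 * s
    · have h1 := gle z p hp hz (by linarith)
      have h2 := hA z (by linarith)
      rw [e1]
      refine (norm_add_le _ _).trans ?_
      by_cases hz' : ‖z' - c‖ < 7 / 4 * s
      · have h3 : ‖g z - g z'‖ ≤ lam * ‖z - z'‖ + β := by
          rw [gdiff]
          have h4 := h.F_small (z - c) (z' - c) (by linarith) (by linarith)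
          rw [sub_sub_sub_cancel_right] at h4
          have h5 := hQ hz hz'
          have h3 := norm_sub_le (F (z - c) - F (z' - c)) ((z - z') - P (z - z'))
          linarith
        have h4 : ‖χ z' • (g z - g z')‖ ≤ ‖g z - g z'‖ := by
          rw [norm_smul, Real.norm_of_nonneg (χ0 z')]
          exact mul_le_of_le_one_left (norm_nonneg _) (χ1 z')
        linarith
      · rw [χout z' (not_lt.mp hz')] at h2 ⊢
        rw [zero_smul, norm_zero]
        linarith
    · rw [e2]
      by_cases hz' : ‖z' - c‖ < 7 / 4 * s
      · have h1 := gle z' p' hp' hz' (by linarith)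
        have h2 := hA z' (by linarith)
        refine (norm_add_le _ _).trans ?_
        rw [χout z (not_lt.mp hz)] at h2 ⊢
        rw [zero_smul, norm_zero]
        linarith
      · rw [χout z (not_lt.mp hz), χout z' (not_lt.mp hz')]
        simp only [sub_self, zero_smul, add_zero, norm_zero]
        linarith
open Classical in
theorem build_map {R lam s e ρ : ℝ} {N : ℕ} {S₁ S₂ : Set E} (hs : 0 < s) (hR : 16 * s ≤ R)
    (hlam0 : 0 ≤ lam) (hlam : lam ≤ e / 2) (he : 0 < e) (he1 : e ≤ 1) (hρ : 0 < ρ)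
    (hρs : 8 * (3 ^ N * ρ) ≤ e * s)
    (hP : ∀ c ∈ S₁, ∃ P F, GPatch R lam s S₁ c P F ∧ ∀ x ∈ S₂, ∀ x' ∈ S₂, ‖x - c‖ ≤ 2 * s →
      ‖x' - c‖ ≤ 2 * s → ‖(x - x') - P (x - x')‖ ≤ e * ‖x - x'‖)
    (hd : ∀ x ∈ S₂, ∃ p ∈ S₁, ‖x - p‖ ≤ ρ) (F₀ : Finset E) (hF₀ : ∀ c ∈ F₀, c ∈ S₁)
    (hN : ∀ x, (F₀.filter (fun c => ‖x - c‖ ≤ 2 * s)).card ≤ N) :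
    ∃ φ : E → E, (∀ x ∈ S₂, ‖φ x - x‖ ≤ 3 ^ N * ρ) ∧
      (∀ x ∈ S₂, ∀ x' ∈ S₂, ‖(φ x - x) - (φ x' - x')‖ ≤ 4 ^ (2 * N) * e * ‖x - x'‖) ∧
      (∀ x ∈ S₂, (∃ c ∈ F₀, ‖x - c‖ ≤ 9 / 8 * s) → φ x ∈ S₁) := by
  set k : Finset E → E → ℕ := fun F x => (F.filter (fun c => ‖x - c‖ ≤ 2 * s)).card with hk
  have kN : ∀ F ⊆ F₀, ∀ x, k F x ≤ N := fun F hF x =>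
    (Finset.card_le_card (Finset.filter_subset_filter _ hF)).trans (hN x)
  have kmono : ∀ F c x, k F x ≤ k (insert c F) x := fun F c x =>
    Finset.card_le_card (Finset.filter_subset_filter _ (Finset.subset_insert _ _))
  have ksucc : ∀ F c x, c ∉ F → ‖x - c‖ ≤ 2 * s → k (insert c F) x = k F x + 1 := by
    intro F c x hc hx
    simp only [hk]
    rw [Finset.filter_insert, if_pos hx, Finset.card_insert_of_notMem]
    simp [hc]
  have hes : e * s ≤ s := mul_le_of_le_one_left hs.le he1
  have main : ∀ F : Finset E, F ⊆ F₀ → ∃ φ : E → E,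
      (∀ x ∈ S₂, ‖φ x - x‖ ≤ (3 ^ (k F x) - 1) * ρ) ∧
      (∀ x ∈ S₂, ∀ x' ∈ S₂, ‖(φ x - x) - (φ x' - x')‖ ≤
        (4 ^ (k F x + k F x') - 1) * e * ‖x - x'‖) ∧
      (∀ x ∈ S₂, (∃ c ∈ F, ‖x - c‖ ≤ 9 / 8 * s) → φ x ∈ S₁) := by
    intro F
    induction F using Finset.induction_on with
    | empty =>
      intro _
      refine ⟨fun x => x, ?_, ?_, ?_⟩
      · intro x _; simp [hk]
      · intro x _ x' _; simp [hk]
      · rintro x _ ⟨c, hc, _⟩; simp at hc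
    | insert c F hc ih =>
      intro hF
      have hFs : F ⊆ F₀ := (Finset.subset_insert _ _).trans hF
      obtain ⟨φ, φ1, φ2, φ3⟩ := ih hFs
      have hcS : c ∈ S₁ := hF₀ c (hF (Finset.mem_insert_self _ _))
      obtain ⟨P, G, hG, htilt⟩ := hP c hcS
      obtain ⟨Φ, Φout, Φdisp, Φfix, Φin, Φlip⟩ := hG.step hs hR hlam0
      have pow3 : ∀ x, (3 : ℝ) ^ (k F x) * ρ ≤ 3 ^ N * ρ := by
        intro x
        have := pow_le_pow_right₀ (by norm_num : (1 : ℝ) ≤ 3) (kN F hFs x)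
        gcongr
      have near : ∀ x ∈ S₂, ∃ p ∈ S₁, ‖φ x - p‖ ≤ 3 ^ (k F x) * ρ := by
        intro x hx
        obtain ⟨p, hp, hxp⟩ := hd x hx
        refine ⟨p, hp, ?_⟩
        have h1 := norm_add_le (φ x - x) (x - p)
        rw [sub_add_sub_cancel] at h1
        have h2 := φ1 x hx
        linarith
      have disp8 : ∀ x ∈ S₂, ‖φ x - x‖ ≤ s / 8 := by
        intro x hx
        have h2 := φ1 x hx
        have := pow3 x
        linarith
      have touch : ∀ x ∈ S₂, ‖φ x - c‖ < 7 / 4 * s → ‖x - c‖ ≤ 2 * s := by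
        intro x hx h
        have h1 := norm_sub_le (φ x - c) (φ x - x)
        rw [sub_sub_sub_cancel_left] at h1
        have := disp8 x hx
        linarith
      refine ⟨fun x => Φ (φ x), ?_, ?_, ?_⟩
      · intro x hx
        by_cases ht : ‖φ x - c‖ < 7 / 4 * s
        · rw [ksucc F c x hc (touch x hx ht), pow_succ]
          obtain ⟨p, hp, hxp⟩ := near x hx
          have h3 := pow3 x
          have h1 := Φdisp (φ x) p hp (by linarith)
          have h2 := norm_add_le (Φ (φ x) - φ x) (φ x - x)
          rw [sub_add_sub_cancel] at h2
          have h4 := φ1 x hx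
          linarith
        · beta_reduce
          rw [Φout _ (not_lt.mp ht)]
          refine (φ1 x hx).trans ?_
          have := pow_le_pow_right₀ (by norm_num : (1 : ℝ) ≤ 3) (kmono F c x)
          gcongr
      · intro x hx x' hx'
        have hb := φ2 x hx x' hx'
        set b : ℝ := (4 ^ (k F x + k F x') - 1) * e with hbdef
        have hb0 : 0 ≤ b := by
          have : (1 : ℝ) ≤ 4 ^ (k F x + k F x') := one_le_pow₀ (by norm_num)
          have : (0 : ℝ) ≤ 4 ^ (k F x + k F x') - 1 := by linarith
          positivity
        by_cases ht : ‖φ x - c‖ < 7 / 4 * s ∨ ‖φ x' - c‖ < 7 / 4 * s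
        · have hcount : k F x + k F x' + 1 ≤ k (insert c F) x + k (insert c F) x' := by
            have m1 := kmono F c x
            have m2 := kmono F c x'
            rcases ht with ht | ht
            · have := ksucc F c x hc (touch x hx ht)
              omega
            · have := ksucc F c x' hc (touch x' hx' ht)
              omega
          obtain ⟨p, hp, hxp⟩ := near x hx
          obtain ⟨p', hp', hxp'⟩ := near x' hx'
          set t := ‖x - x'‖ with htdef
          have ht0 : 0 ≤ t := norm_nonneg _
          have hzz : ‖φ x - φ x'‖ ≤ (1 + b) * t := by
            have := norm_add_le (x - x') ((φ x - x) - (φ x' - x'))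
            rw [show (x - x') + ((φ x - x) - (φ x' - x')) = φ x - φ x' by abel] at this
            linarith
          have hl := Φlip (φ x) (φ x') p hp p' hp' (3 ^ N * ρ) ((e + b) * t) (by linarith)
            (by positivity) (hxp.trans (pow3 x)) (hxp'.trans (pow3 x')) (by
              intro h1 h2
              have h3 := htilt x hx x' hx' (touch x hx h1) (touch x' hx' h2)
              have h4 := hG.Q_le ((φ x - x) - (φ x' - x'))
              have h5 := norm_add_le ((x - x') - P (x - x'))
                (((φ x - x) - (φ x' - x')) - P ((φ x - x) - (φ x' - x')))
              rw [show ((x - x') - P (x - x')) +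
                (((φ x - x) - (φ x' - x')) - P ((φ x - x) - (φ x' - x')))
                = (φ x - φ x') - P (φ x - φ x') by
                  simp only [map_sub]; abel] at h5
              linarith)
          have hDs : 4 * (3 ^ N * ρ) / s ≤ e / 2 := by
            rw [div_le_iff₀ hs]; linarith
          have h6 : (4 * (3 ^ N * ρ) / s + lam) * ‖φ x - φ x'‖ ≤ e * ((1 + b) * t) := by
            gcongr
            linarith
          have h7 : e * (b * t) ≤ b * t := mul_le_of_le_one_left (by positivity) he1
          have h8 := norm_add_le ((Φ (φ x) - φ x) - (Φ (φ x') - φ x')) ((φ x - x) - (φ x' - x'))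
          rw [show ((Φ (φ x) - φ x) - (Φ (φ x') - φ x')) + ((φ x - x) - (φ x' - x'))
            = (Φ (φ x) - x) - (Φ (φ x') - x') by abel] at h8
          have h9 : ‖(Φ (φ x) - x) - (Φ (φ x') - x')‖ ≤ (4 * b + 3 * e) * t := by
            have : 0 ≤ e * t := by positivity
            have : 0 ≤ b * t := by positivity
            linarith
          refine h9.trans ?_
          have h10 : (4 : ℝ) * b + 3 * e = (4 ^ (k F x + k F x' + 1) - 1) * e := by
            rw [hbdef, pow_succ]; ring
          rw [h10]
          have := pow_le_pow_right₀ (by norm_num : (1 : ℝ) ≤ 4) hcount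
          gcongr
        · push Not at ht
          beta_reduce
          rw [Φout _ ht.1, Φout _ ht.2]
          refine hb.trans ?_
          have := pow_le_pow_right₀ (by norm_num : (1 : ℝ) ≤ 4)
            (add_le_add (kmono F c x) (kmono F c x'))
          rw [hbdef]
          gcongr
      · rintro x hx ⟨c', hc', hxc⟩
        rcases Finset.mem_insert.mp hc' with rfl | hc'
        · obtain ⟨p, hp, hxp⟩ := near x hx
          have h3 := pow3 x
          refine Φin (φ x) p hp ?_ (by linarith)
          have h1 := norm_add_le (φ x - x) (x - c')
          rw [sub_add_sub_cancel] at h1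
          have := disp8 x hx
          linarith
        · have := φ3 x hx ⟨c', hc', hxc⟩
          show Φ (φ x) ∈ S₁
          rw [Φfix _ this]
          exact this
  obtain ⟨φ, φ1, φ2, φ3⟩ := main F₀ subset_rfl
  refine ⟨φ, ?_, ?_, φ3⟩
  · intro x hx
    refine (φ1 x hx).trans ?_
    have := pow_le_pow_right₀ (by norm_num : (1 : ℝ) ≤ 3) (kN F₀ subset_rfl x)
    gcongr
    linarith
  · intro x hx x' hx'
    refine (φ2 x hx x' hx').trans ?_
    have h1 := kN F₀ subset_rfl x
    have h2 := kN F₀ subset_rfl x'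
    have := pow_le_pow_right₀ (by norm_num : (1 : ℝ) ≤ 4)
      (show k F₀ x + k F₀ x' ≤ 2 * N by omega)
    gcongr
    linarith

theorem exists_separated {S : Set E} (hS : IsCompact S) {s : ℝ} (hs : 0 < s) :
    ∃ F : Finset E, (∀ c ∈ F, c ∈ S) ∧ (∀ c ∈ F, ∀ c' ∈ F, c ≠ c' → s ≤ ‖c - c'‖) ∧
      ∀ p ∈ S, ∃ c ∈ F, ‖p - c‖ ≤ s := by
  classical
  by_contra hcon
  push Not at hcon
  obtain ⟨t, -, htf, ht⟩ := hS.finite_cover_balls (half_pos hs)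
  have : ∀ k : ℕ, ∃ F : Finset E, (∀ c ∈ F, c ∈ S) ∧
      (∀ c ∈ F, ∀ c' ∈ F, c ≠ c' → s ≤ ‖c - c'‖) ∧ F.card = k := by
    intro k
    induction k with
    | zero => exact ⟨∅, by simp, by simp, by simp⟩
    | succ k ih =>
      obtain ⟨F, h1, h2, h3⟩ := ih
      obtain ⟨p, hp, hpF⟩ := hcon F h1 h2
      have hpn : p ∉ F := by
        intro h
        have := hpF p h
        simp at this
        linarith
      refine ⟨insert p F, ?_, ?_, by rw [Finset.card_insert_of_notMem hpn, h3]⟩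
      · intro c hc
        rcases Finset.mem_insert.mp hc with rfl | hc
        · exact hp
        · exact h1 c hc
      · intro c hc c' hc' hne
        rcases Finset.mem_insert.mp hc with e1 | e1 <;>
          rcases Finset.mem_insert.mp hc' with e2 | e2
        · exact absurd (e1.trans e2.symm) hne
        · rw [e1]; exact (hpF c' e2).le
        · rw [e2, norm_sub_rev]; exact (hpF c e1).le
        · exact h2 c e1 c' e2 hne
  obtain ⟨F, h1, h2, h3⟩ := this (htf.toFinset.card + 1)
  have hch : ∀ c ∈ F, ∃ y ∈ htf.toFinset, ‖c - y‖ < s / 2 := by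
    intro c hc
    have := ht (h1 c hc)
    simp only [mem_iUnion, mem_ball, dist_eq_norm] at this
    obtain ⟨y, hy, hcy⟩ := this
    exact ⟨y, by simpa using hy, hcy⟩
  choose! y hy hcy using hch
  have : F.card ≤ htf.toFinset.card := by
    refine Finset.card_le_card_of_injOn y hy ?_
    intro c hc c' hc' heq
    by_contra hne
    have h4 := h2 c hc c' hc' hne
    have h5 := hcy c hc
    have h6 := hcy c' hc'
    have h7 := norm_sub_le (c - y c) (c' - y c')
    rw [heq, sub_sub_sub_cancel_right] at h7
    rw [heq] at h5
    linarith
  omega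

open Classical in
theorem card_near_le [FiniteDimensional ℝ E] {F : Finset E} {s : ℝ} (hs : 0 < s)
    (h : ∀ c ∈ F, ∀ c' ∈ F, c ≠ c' → s ≤ ‖c - c'‖) (x : E) :
    (F.filter (fun c => ‖x - c‖ ≤ 2 * s)).card ≤ 5 ^ Module.finrank ℝ E := by
  have hinj : Function.Injective (fun c : E => s⁻¹ • (x - c)) := by
    intro a b hab
    have := smul_right_injective E (inv_ne_zero hs.ne') hab
    exact sub_right_injective this
  rw [← Finset.card_image_of_injective _ hinj]
  apply Besicovitch.card_le_of_separated
  · intro c hc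
    obtain ⟨a, ha, rfl⟩ := Finset.mem_image.mp hc
    rw [norm_smul, norm_inv, Real.norm_of_nonneg hs.le, inv_mul_le_iff₀ hs, mul_comm]
    exact (Finset.mem_filter.mp ha).2
  · intro c hc c' hc' hne
    obtain ⟨a, ha, rfl⟩ := Finset.mem_image.mp hc
    obtain ⟨a', ha', rfl⟩ := Finset.mem_image.mp hc'
    have h1 : a ≠ a' := fun h => hne (by rw [h])
    have h2 := h a (Finset.mem_filter.mp ha).1 a' (Finset.mem_filter.mp ha').1 h1
    rw [← smul_sub, norm_smul, norm_inv, Real.norm_of_nonneg hs.le, sub_sub_sub_cancel_left,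
      norm_sub_rev, inv_mul_eq_div, one_le_div hs]
    exact h2

theorem surj_of_close [CompleteSpace E] {R lam s e ρ : ℝ} {S₁ S₂ : Set E} {φ : E → E} {y x₀ : E}
    {P : E →L[ℝ] E} {F : E → E} (hG : GPatch R lam s S₂ x₀ P F) (hs : 0 < s) (hR : 16 * s ≤ R)
    (he : e < 1)
    (htilt : ∀ x ∈ S₁, ∀ x' ∈ S₁, ‖x - x₀‖ ≤ 2 * s →
      ‖x' - x₀‖ ≤ 2 * s → ‖(x - x') - P (x - x')‖ ≤ e * ‖x - x'‖)
    (hρ : ρ ≤ s / 8) (hy : y ∈ S₁) (hyx : ‖y - x₀‖ ≤ ρ)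
    (φ1 : ∀ x ∈ S₂, ‖φ x - x‖ ≤ s / 8)
    (φ2 : ∀ x ∈ S₂, ∀ x' ∈ S₂, ‖(φ x - x) - (φ x' - x')‖ ≤ 1 / 4 * ‖x - x'‖)
    (φ3 : ∀ x ∈ S₂, φ x ∈ S₁) : ∃ x ∈ S₂, φ x = y := by
  set X : E → E := fun ζ => x₀ + P ζ + F ζ with hX
  have Xn : ∀ ζ, ‖X ζ - x₀‖ ≤ 2 * ‖ζ‖ := by
    intro ζ
    have h1 := hG.P_le ζ
    have h2 := hG.F_lip ζ 0
    rw [hG.F_zero, sub_zero, sub_zero] at h2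
    have h3 := norm_add_le (P ζ) (F ζ)
    have : X ζ - x₀ = P ζ + F ζ := by simp only [hX]; abel
    rw [this]; linarith
  have Xmem : ∀ ζ, ‖ζ‖ ≤ s / 2 → X ζ ∈ S₂ := by
    intro ζ hζ
    refine hG.mem' ζ ?_
    have := Xn ζ
    have h3 : X ζ - x₀ = P ζ + F ζ := by simp only [hX]; abel
    rw [h3] at this
    linarith
  have Xlip : ∀ ζ η, ‖X ζ - X η‖ ≤ 2 * ‖ζ - η‖ := by
    intro ζ η
    have h1 := hG.P_le (ζ - η)
    have h2 := hG.F_lip ζ η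
    have h3 := norm_add_le (P (ζ - η)) (F ζ - F η)
    have : X ζ - X η = P (ζ - η) + (F ζ - F η) := by simp only [hX, map_sub]; abel
    rw [this]; linarith
  set K : E → E := fun ζ => P (y - x₀) - P (φ (X ζ) - X ζ) with hK
  have maps : MapsTo K (closedBall 0 (s / 2)) (closedBall 0 (s / 2)) := by
    intro ζ hζ
    rw [mem_closedBall_zero_iff] at hζ ⊢
    have h1 := hG.P_le (y - x₀)
    have h2 := hG.P_le (φ (X ζ) - X ζ)
    have h3 := φ1 _ (Xmem ζ hζ)
    have h4 := norm_sub_le (P (y - x₀)) (P (φ (X ζ) - X ζ))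
    show ‖P (y - x₀) - P (φ (X ζ) - X ζ)‖ ≤ s / 2
    linarith
  have hcontr : ContractingWith (1 / 2 : ℝ≥0) (maps.restrict K _ _) := by
    refine ⟨by norm_num, LipschitzWith.of_dist_le_mul ?_⟩
    rintro ⟨ζ, hζ⟩ ⟨η, hη⟩
    rw [Subtype.dist_eq, Subtype.dist_eq, dist_eq_norm, dist_eq_norm]
    rw [mem_closedBall_zero_iff] at hζ hη
    simp only [MapsTo.val_restrict_apply]
    have h1 := φ2 _ (Xmem ζ hζ) _ (Xmem η hη)
    have h2 := Xlip ζ η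
    have h3 := hG.P_le ((φ (X ζ) - X ζ) - (φ (X η) - X η))
    have h4 : K ζ - K η = - P ((φ (X ζ) - X ζ) - (φ (X η) - X η)) := by
      rw [map_sub]; simp only [hK]; abel
    rw [h4, norm_neg]
    have : ((1 / 2 : ℝ≥0) : ℝ) = 1 / 2 := by norm_num
    rw [this]
    linarith
  obtain ⟨ζ, hζ, hfix, -⟩ := ContractingWith.exists_fixedPoint' (isClosed_closedBall.isComplete)
    maps hcontr (x := 0) (by rw [mem_closedBall_zero_iff, norm_zero]; linarith) (edist_ne_top _ _)
  rw [mem_closedBall_zero_iff] at hζ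
  have hfix' : P (y - x₀) - P (φ (X ζ) - X ζ) = ζ := hfix
  refine ⟨X ζ, Xmem ζ hζ, ?_⟩
  have hPζ : P ζ = ζ := by
    conv_lhs => rw [← hfix']
    rw [map_sub, hG.PP, hG.PP, hfix']
  have hPX : P (X ζ - x₀) = ζ := by
    have : X ζ - x₀ = P ζ + F ζ := by simp only [hX]; abel
    rw [this, map_add, hG.PP, hG.PF, add_zero, hPζ]
  have hP0 : P (φ (X ζ) - y) = 0 := by
    have : φ (X ζ) - y = (φ (X ζ) - X ζ) + (X ζ - x₀) - (y - x₀) := by abel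
    rw [this, map_sub, map_add, hPX, sub_eq_zero]
    exact (sub_eq_iff_eq_add'.mp hfix').symm
  have h1 := φ1 _ (Xmem ζ hζ)
  have h2 := htilt (φ (X ζ)) (φ3 _ (Xmem ζ hζ)) y hy (by
    have h3 := norm_add_le (φ (X ζ) - X ζ) (X ζ - x₀)
    rw [sub_add_sub_cancel] at h3
    have := Xn ζ
    linarith) (by linarith)
  rw [hP0, sub_zero] at h2
  have h3 : ‖φ (X ζ) - y‖ = 0 := by
    have := norm_nonneg (φ (X ζ) - y)
    nlinarith
  exact sub_eq_zero.mp (norm_eq_zero.mp h3)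

end Aux

theorem isotopic_of_map {n : ℕ} {S₁ S₂ : Set (EuclideanSpace ℝ (Fin n))}
    {φ : EuclideanSpace ℝ (Fin n) → EuclideanSpace ℝ (Fin n)} {ε : ℝ≥0}
    (hε : lipschitzExtensionConstant (EuclideanSpace ℝ (Fin n)) * ε ≤ 1 / 2)
    (φ2 : ∀ x ∈ S₂, ∀ x' ∈ S₂, ‖(φ x - x) - (φ x' - x')‖ ≤ ε * ‖x - x'‖)
    (him : φ '' S₂ = S₁) : AmbientIsotopic n S₁ S₂ := by
  have hl : LipschitzOnWith ε (fun x => φ x - x) S₂ := by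
    refine LipschitzOnWith.of_dist_le_mul ?_
    intro x hx y hy
    rw [dist_eq_norm, dist_eq_norm]
    exact φ2 x hx y hy
  obtain ⟨g, hg, hgeq⟩ := hl.extend_finite_dimension
  have hg' := hg.weaken hε
  have hgc := hg.continuous
  refine ⟨fun q => q.1 + (1 - q.2) • g q.1, by fun_prop, ?_, by simp, ?_⟩
  · intro t ht
    have hanti : AntilipschitzWith 2 (fun x => x + (1 - t) • g x) := by
      refine AntilipschitzWith.of_le_mul_dist ?_
      intro x y
      rw [dist_eq_norm, dist_eq_norm]
      have h1 := hg'.dist_le_mul x y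
      rw [dist_eq_norm, dist_eq_norm] at h1
      have : ((1 / 2 : ℝ≥0) : ℝ) = 1 / 2 := by norm_num
      rw [this] at h1
      have h2 : ‖(1 - t) • (g x - g y)‖ ≤ ‖g x - g y‖ := by
        rw [norm_smul, Real.norm_of_nonneg (by linarith [ht.2])]
        exact mul_le_of_le_one_left (norm_nonneg _) (by linarith [ht.1])
      have h3 := norm_sub_le ((x + (1 - t) • g x) - (y + (1 - t) • g y)) ((1 - t) • (g x - g y))
      rw [show (x + (1 - t) • g x) - (y + (1 - t) • g y) - (1 - t) • (g x - g y) = x - y by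
        module] at h3
      have : ((2 : ℝ≥0) : ℝ) = 2 := by norm_num
      rw [this]
      linarith
    have huc : UniformContinuous (fun x => x + (1 - t) • g x) :=
      uniformContinuous_id.add (hg.uniformContinuous.const_smul (1 - t))
    exact (hanti.isUniformEmbedding huc).isEmbedding
  · rw [← him]
    refine Set.image_congr ?_
    intro x hx
    have : φ x - x = g x := hgeq hx
    simp [← this]

/-- **Ambient isotopy for Hausdorff-close manifolds** (Corollary 4.10): there is
`ρ = ρ(R,L,α,m,n) > 0` such that any two manifolds in `C^{1,α}_{m,n}(R,L,d)` at Hausdorff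
distance at most `ρ` are ambient isotopic. -/
theorem hausdorff_close_implies_isotopic (m n : ℕ) (R L α : ℝ)
    (hm : 1 ≤ m) (hmn : m < n) (hR : 0 < R) (hL : 0 < L) (hα : 0 < α) (hα1 : α ≤ 1) :
    ∃ ρ : ℝ, 0 < ρ ∧ ∀ d : ℝ, 0 < d →
      ∀ S₁ S₂ : Set (EuclideanSpace ℝ (Fin n)),
        InClassC1 m n R L d α S₁ → InClassC1 m n R L d α S₂ →
        Metric.hausdorffDist S₁ S₂ ≤ ρ → AmbientIsotopic n S₁ S₂ := by
  have hC := lipschitzExtensionConstant_pos (EuclideanSpace ℝ (Fin n))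
  set C := lipschitzExtensionConstant (EuclideanSpace ℝ (Fin n)) with hCdef
  set N : ℕ := 5 ^ Module.finrank ℝ (EuclideanSpace ℝ (Fin n)) with hNdef
  have h4 : (1 : ℝ) ≤ 4 ^ (2 * N) := one_le_pow₀ (by norm_num)
  have h3 : (1 : ℝ) ≤ 3 ^ N := one_le_pow₀ (by norm_num)
  have hC' : (0 : ℝ) < C := by exact_mod_cast hC
  obtain ⟨e, he, heC, he4⟩ : ∃ e : ℝ, 0 < e ∧ C * (4 ^ (2 * N) * e) ≤ 1 / 2 ∧
      4 ^ (2 * N) * e ≤ 1 / 4 := by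
    refine ⟨min (1 / 2 / (C * 4 ^ (2 * N))) (1 / 4 / 4 ^ (2 * N)), by positivity, ?_, ?_⟩
    · have := min_le_left (1 / 2 / (C * 4 ^ (2 * N)) : ℝ) (1 / 4 / 4 ^ (2 * N))
      rw [le_div_iff₀ (by positivity)] at this
      linarith
    · have := min_le_right (1 / 2 / (C * 4 ^ (2 * N)) : ℝ) (1 / 4 / 4 ^ (2 * N))
      rw [le_div_iff₀ (by positivity)] at this
      linarith
  have he1 : e ≤ 1 / 4 := (le_mul_of_one_le_left he.le h4).trans he4
  obtain ⟨s, hs, hsR, hlam⟩ : ∃ s : ℝ, 0 < s ∧ 16 * s ≤ R ∧ L * (8 * s) ^ α ≤ e / 10 := by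
    have hlim : Tendsto (fun s : ℝ => L * (8 * s) ^ α) (𝓝[>] 0) (𝓝 0) := by
      have : ContinuousAt (fun s : ℝ => L * (8 * s) ^ α) 0 :=
        ((continuousAt_const.mul continuousAt_id).rpow_const (Or.inr hα.le)).const_mul L
      have h0 := this.tendsto
      simp only [mul_zero, Real.zero_rpow hα.ne'] at h0
      exact h0.mono_left nhdsWithin_le_nhds
    have h1 := hlim.eventually_le_const (show (0 : ℝ) < e / 10 by positivity)
    have h2 : ∀ᶠ s : ℝ in 𝓝[>] 0, s ∈ Ioo 0 (R / 16) := Ioo_mem_nhdsGT (by positivity)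
    obtain ⟨s, hs1, hs2⟩ := (h1.and h2).exists
    exact ⟨s, hs2.1, by linarith [hs2.2], hs1⟩
  set lam := L * (8 * s) ^ α with hlamdef
  have hlam0 : 0 ≤ lam := by positivity
  obtain ⟨ρ, hρ, hρs⟩ : ∃ ρ : ℝ, 0 < ρ ∧ 8 * (3 ^ N * ρ) ≤ e * s := by
    refine ⟨e * s / (8 * 3 ^ N), by positivity, le_of_eq ?_⟩
    field_simp
  have hρ3 : ρ ≤ 3 ^ N * ρ := le_mul_of_one_le_left hρ.le h3
  have hes : e * s ≤ 1 / 4 * s := by gcongr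
  have hρe : 2 * ρ / s + 5 * lam ≤ e := by
    have : 2 * ρ / s ≤ e / 4 := by rw [div_le_iff₀ hs]; linarith
    linarith
  refine ⟨ρ / 2, by positivity, ?_⟩
  intro d hd S₁ S₂ hS₁ hS₂ hH
  obtain ⟨ne₁, c₁, -, g₁⟩ := hS₁
  obtain ⟨ne₂, c₂, -, g₂⟩ := hS₂
  have htop : hausdorffEDist S₁ S₂ ≠ ⊤ :=
    hausdorffEDist_ne_top_of_nonempty_of_bounded ne₁ ne₂ c₁.isBounded c₂.isBounded
  have d₁ : ∀ x ∈ S₁, ∃ p ∈ S₂, ‖x - p‖ ≤ ρ := by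
    intro x hx
    obtain ⟨p, hp, h⟩ := exists_dist_lt_of_hausdorffDist_lt hx
      (show hausdorffDist S₁ S₂ < ρ by linarith) htop
    exact ⟨p, hp, by rw [← dist_eq_norm]; exact h.le⟩
  have d₂ : ∀ x ∈ S₂, ∃ p ∈ S₁, ‖x - p‖ ≤ ρ := by
    intro x hx
    obtain ⟨p, hp, h⟩ := exists_dist_lt_of_hausdorffDist_lt' hx
      (show hausdorffDist S₁ S₂ < ρ by linarith) htop
    exact ⟨p, hp, by rw [← dist_eq_norm, dist_comm]; exact h.le⟩
  have G₁ : ∀ x ∈ S₁, ∃ P F, GPatch R lam s S₁ x P F := fun x hx => by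
    obtain ⟨T, hT⟩ := g₁ x hx
    exact GPatch.exists hL hα hs hT
  have G₂ : ∀ x ∈ S₂, ∃ P F, GPatch R lam s S₂ x P F := fun x hx => by
    obtain ⟨T, hT⟩ := g₂ x hx
    exact GPatch.exists hL hα hs hT
  have T₁ : ∀ c ∈ S₁, ∃ P F, GPatch R lam s S₁ c P F ∧ ∀ x ∈ S₂, ∀ x' ∈ S₂, ‖x - c‖ ≤ 2 * s →
      ‖x' - c‖ ≤ 2 * s → ‖(x - x') - P (x - x')‖ ≤ e * ‖x - x'‖ := by
    intro c hc
    obtain ⟨P, F, hG⟩ := G₁ c hc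
    refine ⟨P, F, hG, ?_⟩
    intro x hx x' hx' hxc hxc'
    obtain ⟨P', F', hG'⟩ := G₂ x' hx'
    exact (hG.tilt hG' hs hsR hlam0 hρ (by linarith) d₂ hx' hx hxc' hxc).trans (by gcongr)
  have T₂ : ∀ c ∈ S₂, ∃ P F, GPatch R lam s S₂ c P F ∧ ∀ x ∈ S₁, ∀ x' ∈ S₁, ‖x - c‖ ≤ 2 * s →
      ‖x' - c‖ ≤ 2 * s → ‖(x - x') - P (x - x')‖ ≤ e * ‖x - x'‖ := by
    intro c hc
    obtain ⟨P, F, hG⟩ := G₂ c hc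
    refine ⟨P, F, hG, ?_⟩
    intro x hx x' hx' hxc hxc'
    obtain ⟨P', F', hG'⟩ := G₁ x' hx'
    exact (hG.tilt hG' hs hsR hlam0 hρ (by linarith) d₁ hx' hx hxc' hxc).trans (by gcongr)
  obtain ⟨F₀, F₀S, F₀sep, F₀cov⟩ := exists_separated c₁ hs
  obtain ⟨φ, φ1, φ2, φ3⟩ := build_map hs hsR hlam0 (by linarith) he (by linarith) hρ hρs T₁ d₂
    F₀ F₀S (card_near_le hs F₀sep)
  have φ3' : ∀ x ∈ S₂, φ x ∈ S₁ := by
    intro x hx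
    refine φ3 x hx ?_
    obtain ⟨p, hp, hxp⟩ := d₂ x hx
    obtain ⟨c, hc, hpc⟩ := F₀cov p hp
    refine ⟨c, hc, ?_⟩
    have := norm_add_le (x - p) (p - c)
    rw [sub_add_sub_cancel] at this
    linarith
  obtain ⟨ε, hε⟩ : ∃ ε : ℝ≥0, (ε : ℝ) = 4 ^ (2 * N) * e :=
    ⟨Real.toNNReal (4 ^ (2 * N) * e), Real.coe_toNNReal _ (by positivity)⟩
  refine isotopic_of_map (φ := φ) (ε := ε) ?_ (by rw [hε]; exact φ2) ?_
  · rw [← NNReal.coe_le_coe, NNReal.coe_mul, hε]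
    refine heC.trans (le_of_eq ?_)
    norm_num
  · refine Subset.antisymm (by rintro _ ⟨x, hx, rfl⟩; exact φ3' x hx) ?_
    intro y hy
    obtain ⟨x₀, hx₀, hyx⟩ := d₁ y hy
    obtain ⟨P, F, hG, ht⟩ := T₂ x₀ hx₀
    refine surj_of_close hG hs hsR (by linarith) ht (by linarith) hy hyx
      (fun x hx => (φ1 x hx).trans (by linarith))
      (fun x hx x' hx' => (φ2 x hx x' hx').trans (by gcongr)) φ3'
end
end

section
/- Fix integers 1 ≤ m < n. There is a constant C > 0 depending only on m with the following property. Let Σ₁, Σ₂ ⊂ ℝⁿ be compact m-dimensional embedded Lipschitz submanifolds, let 0 < ε < 1/2, and let F : Σ₁ → ℝⁿ be a bilipschitz map with F(Σ₁) = Σ₂, of the form F(z) = z + G(z) where G : Σ₁ → ℝⁿ has Lipschitz constant lip(G) ≤ ε. Then for every l ∈ {2,…,m+2} and every tuple T = (x₀,…,x_{l−1}) ∈ Σ₁^l whose points are not all equal, one has |𝒦_l[Σ₂](F(x₀),…,F(x_{l−1})) − 𝒦_l[Σ₁](x₀,…,x_{l−1})| ≤ C · ε / diam{x₀,…,x_{l−1}}.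 -/
open Set Metric MeasureTheory Filter Topology
open scoped ENNReal NNReal

noncomputable section

/-- Discrete Menger curvature (`ℝ≥0∞`-valued): `𝒦 = H^{m+1}(conv)/diam^{m+2}`. -/
def mengerCurv (m n : ℕ) (x : Fin (m + 2) → EuclideanSpace ℝ (Fin n)) : ℝ≥0∞ :=
  μH[(m + 1 : ℝ)] (convexHull ℝ (Set.range x)) / EMetric.diam (Set.range x) ^ (m + 2)

/-- `z : Fin (m+2) → ℝⁿ` extends the `l`-tuple `y`, with all remaining entries in `S`. -/
def ExtendsIn (m n l : ℕ) (S : Set (EuclideanSpace ℝ (Fin n)))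
    (y : Fin l → EuclideanSpace ℝ (Fin n)) (z : Fin (m + 2) → EuclideanSpace ℝ (Fin n)) : Prop :=
  (∀ (i : Fin (m + 2)) (h : (i : ℕ) < l), z i = y ⟨i, h⟩) ∧
  (∀ i : Fin (m + 2), l ≤ (i : ℕ) → z i ∈ S)

/-- `𝒦_l[S](y) = sup_{x_l,…,x_{m+1} ∈ S} 𝒦(y₀,…,y_{l−1},x_l,…,x_{m+1})`
(no supremum is taken when `l = m+2`). -/
def mengerSup (m n l : ℕ) (S : Set (EuclideanSpace ℝ (Fin n)))
    (y : Fin l → EuclideanSpace ℝ (Fin n)) : ℝ≥0∞ :=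
  ⨆ (z : Fin (m + 2) → EuclideanSpace ℝ (Fin n)) (_ : ExtendsIn m n l S y z), mengerCurv m n z

open scoped Classical in
/-- The integrand of `𝓔_p^l`, set to `0` on the diagonal `x₀ = … = x_{l−1}`. -/
def mengerIntegrand (m n l : ℕ) (S : Set (EuclideanSpace ℝ (Fin n)))
    (y : Fin l → EuclideanSpace ℝ (Fin n)) : ℝ≥0∞ :=
  if ∀ i j : Fin l, y i = y j then 0 else mengerSup m n l S y

/-- The geometric curvature energy `𝓔_p^l(S)`: the `p`-th power of `𝒦_l[S]` integrated over
`S^l` with respect to the `l`-fold product of `m`-dimensional Hausdorff measure restricted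
to `S`. -/
def mengerEnergy (m n l : ℕ) (p : ℝ) (S : Set (EuclideanSpace ℝ (Fin n))) : ℝ≥0∞ :=
  ∫⁻ y, mengerIntegrand m n l S y ^ p
    ∂(Measure.pi fun _ : Fin l =>
        (μH[(m : ℝ)] : Measure (EuclideanSpace ℝ (Fin n))).restrict S)

/-- A compact `m`-dimensional embedded Lipschitz submanifold of `ℝⁿ`: a nonempty compact
set which near each of its points is a Lipschitz graph over some `m`-plane. -/
def IsLipschitzSubmanifold (m n : ℕ) (S : Set (EuclideanSpace ℝ (Fin n))) : Prop :=
  S.Nonempty ∧ IsCompact S ∧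
  ∀ x ∈ S, ∃ r : ℝ, 0 < r ∧ ∃ T : Submodule ℝ (EuclideanSpace ℝ (Fin n)),
    Module.finrank ℝ T = m ∧ ∃ f : T → Tᗮ, (∃ K : ℝ≥0, LipschitzWith K f) ∧
      S ∩ Metric.ball x r
        = (Set.range fun ξ : T =>
            x + (ξ : EuclideanSpace ℝ (Fin n)) + (f ξ : EuclideanSpace ℝ (Fin n)))
          ∩ Metric.ball x r


abbrev EE (k : ℕ) := EuclideanSpace ℝ (Fin k)

/-- the standard basis -/
def stdB (k : ℕ) : Module.Basis (Fin k) ℝ (EE k) := (EuclideanSpace.basisFun (Fin k) ℝ).toBasis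

/-- corner tuple -/
def corner (k : ℕ) : Fin (k + 1) → EE k := Fin.cons 0 (fun i => stdB k i)

lemma haus_conv_eq (k : ℕ) (u : Fin (k + 1) → EE k) :
    μH[(k : ℝ)] (convexHull ℝ (Set.range u)) =
      ENNReal.ofReal |(stdB k).det (fun i => u i.succ - u 0)| *
        μH[(k : ℝ)] (convexHull ℝ (Set.range (corner k))) := by
  have hk : Measure.IsAddHaarMeasure (μH[(k : ℝ)] : Measure (EE k)) := by
    simpa using MeasureTheory.isAddHaarMeasure_hausdorffMeasure (E := EuclideanSpace ℝ (Fin k))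
  set B : EE k →ₗ[ℝ] EE k := (stdB k).constr ℝ (fun i => u i.succ - u 0) with hB
  have hBi : ∀ i, B (stdB k i) = u i.succ - u 0 := fun i => by
    simp [hB, Module.Basis.constr_basis]
  have hr : Set.range u = (fun x => u 0 + x) '' (B '' Set.range (corner k)) := by
    rw [← Set.range_comp, ← Set.range_comp]
    congr 1
    funext i
    refine Fin.cases ?_ (fun i => ?_) i
    · simp [corner]
    · simp [corner, hBi]
  have hc : convexHull ℝ (Set.range u) =
      (fun x => u 0 + x) '' (B '' convexHull ℝ (Set.range (corner k))) := by
    rw [LinearMap.image_convexHull, hr]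
    have := convexHull_vadd (𝕜 := ℝ) (u 0) (B '' Set.range (corner k))
    simpa [← Set.image_vadd] using this
  have hd : LinearMap.det B = (stdB k).det (fun i => u i.succ - u 0) := by
    have h := (stdB k).det_comp (B) (stdB k)
    rw [Module.Basis.det_self, mul_one] at h
    rw [← h]
    congr 1
    funext i
    exact hBi i
  rw [hc, Set.image_add_left, measure_preimage_add, Measure.addHaar_image_linearMap, hd]

lemma det_bound (k : ℕ) : ∃ A : ℝ, 0 ≤ A ∧ ∀ (d δ : ℝ) (u v : Fin (k+1) → EE (k+1)), 0 ≤ d → 0 ≤ δ →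
    (∀ i, ‖u i‖ ≤ d) → (∀ i, ‖v i‖ ≤ d) → (∀ i, ‖u i - v i‖ ≤ δ) →
    |(stdB (k+1)).det u| ≤ |(stdB (k+1)).det v| + A * d ^ k * δ := by
  let f : ContinuousMultilinearMap ℝ (fun _ : Fin (k+1) => EE (k+1)) ℝ :=
    { toMultilinearMap := (stdB (k+1)).det.toMultilinearMap
      cont := by
        change Continuous (fun v => (stdB (k+1)).det v)
        simp only [Module.Basis.det_apply]
        refine Continuous.matrix_det ?_
        refine continuous_matrix fun i j => ?_
        simp only [Module.Basis.toMatrix_apply, stdB]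
        simp
        fun_prop }
  refine ⟨‖f‖ * (k+1), by positivity, fun d δ u v hd hδ hu hv huv => ?_⟩
  have h := f.norm_image_sub_le u v
  have h1 : ‖u‖ ≤ d := (pi_norm_le_iff_of_nonneg hd).2 hu
  have h2 : ‖v‖ ≤ d := (pi_norm_le_iff_of_nonneg hd).2 hv
  have h3 : ‖u - v‖ ≤ δ := (pi_norm_le_iff_of_nonneg hδ).2 huv
  have h4 : ‖f‖ * (Fintype.card (Fin (k+1))) * max ‖u‖ ‖v‖ ^ (Fintype.card (Fin (k+1)) - 1) * ‖u - v‖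
      ≤ ‖f‖ * (k + 1) * d ^ k * δ := by
    simp only [Fintype.card_fin, Nat.add_sub_cancel, Nat.cast_add, Nat.cast_one]
    gcongr
    exact max_le h1 h2
  have h5 : |(stdB (k+1)).det u - (stdB (k+1)).det v| ≤ ‖f‖ * (k + 1) * d ^ k * δ := h.trans h4
  have := abs_sub_abs_le_abs_sub ((stdB (k+1)).det u) ((stdB (k+1)).det v)
  linarith

lemma exists_proj (k n : ℕ) (w : Fin (k + 1) → EE n) :
    ∃ P : EE n →ₗ[ℝ] EE k, (∀ x, ‖P x‖ ≤ ‖x‖) ∧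
      ∀ d : ℝ, 0 ≤ d → μH[d] (P '' convexHull ℝ (Set.range w)) = μH[d] (convexHull ℝ (Set.range w)) := by
  let V : Submodule ℝ (EE n) := Submodule.span ℝ (Set.range fun i : Fin k => w i.succ - w 0)
  have hV : Module.finrank ℝ V ≤ k := by
    have := finrank_range_le_card (R := ℝ) (fun i : Fin k => w i.succ - w 0)
    simpa [Set.finrank] using this
  let b := stdOrthonormalBasis ℝ V
  let g : V →ₗ[ℝ] EE k := b.toBasis.constr ℝ (fun i => EuclideanSpace.basisFun (Fin k) ℝ (Fin.castLE hV i))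
  have hg : Orthonormal ℝ (g ∘ b.toBasis) := by
    have : g ∘ b.toBasis = (EuclideanSpace.basisFun (Fin k) ℝ) ∘ (Fin.castLE hV) := by
      funext i
      simp only [g, Function.comp, Module.Basis.constr_basis]
    rw [this]
    exact (EuclideanSpace.basisFun (Fin k) ℝ).orthonormal.comp _ (Fin.castLE_injective hV)
  have hbo : Orthonormal ℝ b.toBasis := by simpa using b.orthonormal
  let gi : V →ₗᵢ[ℝ] EE k := g.isometryOfOrthonormal hbo hg
  let Q : EE n →L[ℝ] V := V.orthogonalProjectionOnto
  refine ⟨gi.toLinearMap ∘ₗ Q.toLinearMap, fun x => ?_, fun d hd => ?_⟩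
  · simp only [LinearMap.comp_apply, LinearIsometry.coe_toLinearMap, LinearIsometry.norm_map]
    exact V.norm_orthogonalProjectionOnto_apply_le x
  · have hconv : ∀ x ∈ convexHull ℝ (Set.range w), x - w 0 ∈ V := by
      intro x hx
      have hcv : Convex ℝ {x | x - w 0 ∈ V} := by
        have := (V.convex).translate_preimage_right (-(w 0))
        have e : {x | x - w 0 ∈ V} = (fun x => -(w 0) + x) ⁻¹' (V : Set (EE n)) := by
          refine Set.ext fun x => ?_
          change x - w 0 ∈ V ↔ -w 0 + x ∈ V
          rw [neg_add_eq_sub]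
        rw [e]
        exact this
      refine convexHull_min ?_ hcv hx
      rintro _ ⟨i, rfl⟩
      refine Fin.cases ?_ (fun i => ?_) i
      · simp
      · exact Submodule.subset_span ⟨i, rfl⟩
    have hiso : ∀ x ∈ convexHull ℝ (Set.range w), ∀ y ∈ convexHull ℝ (Set.range w),
        edist ((gi.toLinearMap ∘ₗ Q.toLinearMap) x) ((gi.toLinearMap ∘ₗ Q.toLinearMap) y) = edist x y := by
      intro x hx y hy
      have hxy : x - y ∈ V := by
        have := V.sub_mem (hconv x hx) (hconv y hy)
        simpa using this
      rw [edist_dist, edist_dist, dist_eq_norm, dist_eq_norm, ← map_sub]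
      simp only [LinearMap.comp_apply, LinearIsometry.coe_toLinearMap, LinearIsometry.norm_map]
      congr 1
      have := V.orthogonalProjectionOnto_mem_subspace_eq_self ⟨x - y, hxy⟩
      simp only [Q, ContinuousLinearMap.coe_coe]
      rw [this]
      rfl
    have hI : Isometry ((convexHull ℝ (Set.range w)).domRestrict (gi.toLinearMap ∘ₗ Q.toLinearMap)) :=
      fun x y => hiso x x.2 y y.2
    have h1 := hI.hausdorffMeasure_image (Or.inl hd) Set.univ
    have h2 := (isometry_subtype_coe (s := convexHull ℝ (Set.range w))).hausdorffMeasure_image (Or.inl hd) Set.univ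
    rw [Set.image_univ, Set.range_domRestrict] at h1
    rw [Set.image_univ, Subtype.range_coe] at h2
    rw [h1, h2]

lemma vol_bound (m : ℕ) : ∃ A : ℝ, 0 ≤ A ∧ ∀ (n : ℕ) (d δ : ℝ) (w z : Fin (m + 2) → EE n), 0 ≤ d → 0 ≤ δ →
    (∀ i j, ‖w i - w j‖ ≤ d) → (∀ i j, ‖z i - z j‖ ≤ d) →
    (∀ i j, ‖(w i - w j) - (z i - z j)‖ ≤ δ) →
    μH[(m + 1 : ℝ)] (convexHull ℝ (Set.range w)) ≤
      μH[(m + 1 : ℝ)] (convexHull ℝ (Set.range z)) + ENNReal.ofReal (A * d ^ m * δ) := by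
  obtain ⟨A, hA, hdet⟩ := det_bound m
  have hk : Measure.IsAddHaarMeasure (μH[((m+1 : ℕ) : ℝ)] : Measure (EE (m+1))) := by
    simpa using MeasureTheory.isAddHaarMeasure_hausdorffMeasure (E := EuclideanSpace ℝ (Fin (m+1)))
  set c : ℝ≥0∞ := μH[((m+1 : ℕ) : ℝ)] (convexHull ℝ (Set.range (corner (m+1)))) with hc
  have hcfin : c ≠ ⊤ := by
    refine ((isBounded_convexHull.2 (Set.finite_range _).isBounded).measure_lt_top).ne
  refine ⟨A * c.toReal, by positivity, fun n d δ w z hd hδ hw hz hwz => ?_⟩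
  obtain ⟨P, hP1, hP2⟩ := exists_proj (m+1) n w
  have hcast : (m + 1 : ℝ) = ((m + 1 : ℕ) : ℝ) := by push_cast; rfl
  have key : ∀ u : Fin (m+2) → EE n, P '' convexHull ℝ (Set.range u) = convexHull ℝ (Set.range (P ∘ u)) := by
    intro u
    rw [LinearMap.image_convexHull, Set.range_comp]
  rw [hcast, ← hP2 _ (by positivity), key, haus_conv_eq _ (P ∘ w)]
  have hz' : μH[((m+1 : ℕ) : ℝ)] (convexHull ℝ (Set.range (P ∘ z))) ≤ μH[((m+1 : ℕ) : ℝ)] (convexHull ℝ (Set.range z)) := by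
    rw [← key]
    have hL : LipschitzWith 1 P := LipschitzWith.of_dist_le_mul fun x y => by
      rw [dist_eq_norm, dist_eq_norm, ← map_sub]
      simpa using hP1 (x - y)
    simpa using hL.hausdorffMeasure_image_le (d := ((m+1 : ℕ) : ℝ)) (by positivity) (convexHull ℝ (Set.range z))
  refine le_trans ?_ (add_le_add_left hz' _)
  rw [haus_conv_eq _ (P ∘ z), ← hc]
  have h := hdet d δ (fun i => (P ∘ w) i.succ - (P ∘ w) 0) (fun i => (P ∘ z) i.succ - (P ∘ z) 0) hd hδ
    (fun i => by
      simp only [Function.comp, ← map_sub]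
      exact (hP1 _).trans (hw _ _))
    (fun i => by
      simp only [Function.comp, ← map_sub]
      exact (hP1 _).trans (hz _ _))
    (fun i => by
      simp only [Function.comp, ← map_sub]
      exact (hP1 _).trans (hwz _ _))
  calc _ ≤ ENNReal.ofReal (|(stdB (m+1)).det (fun i => (P ∘ z) i.succ - (P ∘ z) 0)| + A * d ^ m * δ) * c := by
        gcongr
    _ = _ := by
      rw [ENNReal.ofReal_add (by positivity) (by positivity), add_mul]
      have e : A * c.toReal * d ^ m * δ = A * d ^ m * δ * c.toReal := by ring
      rw [e, ENNReal.ofReal_mul (p := A * d ^ m * δ) (by positivity), ENNReal.ofReal_toReal hcfin]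

lemma real_arith (k : ℕ) (A V V' d d' ε : ℝ) (hd : 0 < d) (hd2 : d ≤ 2 * d') (hdd : d ≤ d' + ε * d)
    (hA : 0 ≤ A) (hε : 0 ≤ ε) (hV0 : 0 ≤ V)
    (hV : V ≤ A * d ^ (k + 1)) (hV' : V' ≤ V + A * ε * d ^ (k + 1)) :
    V' / d' ^ (k + 2) ≤ V / d ^ (k + 2) + (A * (k + 3) * 2 ^ (k + 2)) * ε / d := by
  have hd' : 0 < d' := by linarith
  have hpow : d ^ (k+2) ≤ 2 ^ (k+2) * d' ^ (k+2) := by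
    rw [← mul_pow]; gcongr
  have h1 : V' / d' ^ (k+2) ≤ (V + A * ε * d ^ (k + 1)) / d' ^ (k+2) := by gcongr
  have h2 : (A * ε * d ^ (k + 1)) / d' ^ (k+2) ≤ A * 2 ^ (k+2) * ε / d := by
    rw [div_le_div_iff₀ (by positivity) hd]
    calc A * ε * d ^ (k+1) * d = A * ε * d ^ (k+2) := by ring
      _ ≤ A * ε * (2 ^ (k+2) * d' ^ (k+2)) := by gcongr
      _ = _ := by ring
  have hb : d ^ (k+2) ≤ d' ^ (k+2) + (k+2) * ε * d ^ (k+2) := by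
    rcases le_total d d' with h | h
    · have : d ^ (k+2) ≤ d' ^ (k+2) := by gcongr
      have : 0 ≤ (k+2) * ε * d ^ (k+2) := by positivity
      linarith
    · have ht : -1 ≤ d'/d - 1 := by
        have : 0 ≤ d' / d := by positivity
        linarith
      have := one_add_mul_le_pow (a := d'/d - 1) (by linarith) (k+2)
      have e : 1 - ε ≤ d' / d := by
        rw [le_div_iff₀ hd]; linarith
      have h3 : 1 - (k+2) * ε ≤ (d'/d) ^ (k+2) := by
        refine le_trans ?_ (this.trans_eq (by ring))
        push_cast
        nlinarith [show (0:ℝ) ≤ (k+2) by positivity]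
      rw [div_pow, le_div_iff₀ (by positivity)] at h3
      linarith
  have h3 : V / d' ^ (k+2) ≤ V / d ^ (k+2) + A * (k+2) * 2 ^ (k+2) * ε / d := by
    have : V / d' ^ (k+2) = V / d ^ (k+2) * (d ^ (k+2) / d' ^ (k+2)) := by field_simp
    rw [this]
    have h4 : d ^ (k+2) / d' ^ (k+2) ≤ 1 + (k+2) * ε * 2 ^ (k+2) := by
      rw [div_le_iff₀ (by positivity)]
      have : (k+2) * ε * d ^ (k+2) ≤ (k+2) * ε * (2 ^ (k+2) * d' ^ (k+2)) := by gcongr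
      linarith
    have h5 : V / d ^ (k+2) ≤ A / d := by
      rw [div_le_div_iff₀ (by positivity) hd]
      calc V * d ≤ A * d ^ (k+1) * d := by gcongr
        _ = _ := by ring
    calc _ ≤ V / d ^ (k+2) * (1 + (k+2) * ε * 2 ^ (k+2)) := by gcongr
      _ = V / d ^ (k+2) + V / d ^ (k+2) * ((k+2) * ε * 2 ^ (k+2)) := by ring
      _ ≤ V / d ^ (k+2) + A / d * ((k+2) * ε * 2 ^ (k+2)) := by gcongr
      _ = _ := by ring
  rw [add_div] at h1
  have : (A * (k + 3) * 2 ^ (k + 2)) * ε / d = A * (k+2) * 2 ^ (k+2) * ε / d + A * 2 ^ (k+2) * ε / d := by ring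
  linarith

lemma curv_bound (m : ℕ) : ∃ C : ℝ, 0 < C ∧ ∀ (n : ℕ) (ε : ℝ) (w z : Fin (m + 2) → EE n), 0 ≤ ε →
    0 < Metric.diam (Set.range z) → Metric.diam (Set.range z) ≤ 2 * Metric.diam (Set.range w) →
    Metric.diam (Set.range w) ≤ 2 * Metric.diam (Set.range z) →
    (∀ i j, ‖(w i - w j) - (z i - z j)‖ ≤ ε * Metric.diam (Set.range z)) →
    mengerCurv m n w ≤ mengerCurv m n z + ENNReal.ofReal (C * ε / Metric.diam (Set.range z)) := by
  obtain ⟨A, hA, hvol⟩ := vol_bound m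
  refine ⟨(A * 2 ^ m + 1) * (m + 3) * 2 ^ (m + 2), by positivity, fun n ε w z hε hd hd2 hd3 h => ?_⟩
  have hbw : Bornology.IsBounded (Set.range w) := (Set.finite_range _).isBounded
  have hbz : Bornology.IsBounded (Set.range z) := (Set.finite_range _).isBounded
  set d := Metric.diam (Set.range z) with hdd
  set d' := Metric.diam (Set.range w) with hdd'
  have hd' : 0 < d' := by linarith
  have hw : ∀ i j, ‖w i - w j‖ ≤ d' := fun i j => by
    rw [← dist_eq_norm]; exact Metric.dist_le_diam_of_mem hbw ⟨i, rfl⟩ ⟨j, rfl⟩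
  have hz : ∀ i j, ‖z i - z j‖ ≤ d := fun i j => by
    rw [← dist_eq_norm]; exact Metric.dist_le_diam_of_mem hbz ⟨i, rfl⟩ ⟨j, rfl⟩
  have hdiff : d ≤ d' + ε * d := by
    refine Metric.diam_le_of_forall_dist_le (by positivity) ?_
    rintro _ ⟨i, rfl⟩ _ ⟨j, rfl⟩
    rw [dist_eq_norm]
    have e : z i - z j = (w i - w j) - ((w i - w j) - (z i - z j)) := by abel
    rw [e]
    exact (norm_sub_le _ _).trans (add_le_add (hw i j) (h i j))
  have hew : EMetric.diam (Set.range w) = ENNReal.ofReal d' := by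
    exact (ENNReal.ofReal_toReal hbw.ediam_ne_top).symm
  have hez : EMetric.diam (Set.range z) = ENNReal.ofReal d := by
    exact (ENNReal.ofReal_toReal hbz.ediam_ne_top).symm
  have hA0 : ∀ u : Fin (m+2) → EE n, ∀ r : ℝ, 0 ≤ r → (∀ i j, ‖u i - u j‖ ≤ r) →
      μH[(m + 1 : ℝ)] (convexHull ℝ (Set.range u)) ≤ ENNReal.ofReal (A * r ^ m * r) := by
    intro u r hr hu
    have := hvol n r r u (fun _ => 0) hr hr hu (by simpa using hr) (by simpa using hu)
    have h0 : μH[(m + 1 : ℝ)] (convexHull ℝ (Set.range (fun _ : Fin (m+2) => (0 : EE n)))) = 0 := by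
      haveI : NullSingletonClass (μH[(m + 1 : ℝ)] : Measure (EE n)) :=
        Measure.nullSingletonClass_hausdorff _ (by positivity)
      simp
    rwa [h0, zero_add] at this
  have hVz := hA0 z d hd.le hz
  have hVw := hA0 w d' hd'.le hw
  have hVwz := hvol n (2 * d) (ε * d) w z (by positivity) (by positivity)
    (fun i j => (hw i j).trans hd3) (fun i j => (hz i j).trans (by linarith)) h
  set Vz := μH[(m + 1 : ℝ)] (convexHull ℝ (Set.range z)) with hVzd
  set Vw := μH[(m + 1 : ℝ)] (convexHull ℝ (Set.range w)) with hVwd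
  have hzt : Vz ≠ ⊤ := ne_top_of_le_ne_top ENNReal.ofReal_ne_top hVz
  have hwt : Vw ≠ ⊤ := ne_top_of_le_ne_top ENNReal.ofReal_ne_top hVw
  have r1 : Vz.toReal ≤ (A * 2 ^ m + 1) * d ^ (m + 1) := by
    refine ENNReal.toReal_le_of_le_ofReal (by positivity) (hVz.trans ?_)
    apply ENNReal.ofReal_le_ofReal
    have : A * d ^ m * d = A * 1 * d ^ (m+1) := by ring
    rw [this]
    gcongr
    have : (1:ℝ) ≤ 2 ^ m := one_le_pow₀ (by norm_num)
    nlinarith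
  have r2 : Vw.toReal ≤ Vz.toReal + (A * 2 ^ m + 1) * ε * d ^ (m + 1) := by
    refine ENNReal.toReal_le_of_le_ofReal (by positivity) (hVwz.trans ?_)
    rw [ENNReal.ofReal_add (by positivity) (by positivity), ENNReal.ofReal_toReal hzt]
    refine add_le_add_right (ENNReal.ofReal_le_ofReal ?_) _
    have : A * (2 * d) ^ m * (ε * d) = A * 2 ^ m * ε * d ^ (m+1) := by ring
    rw [this]
    gcongr
    linarith
  have r3 := real_arith m (A * 2 ^ m + 1) Vz.toReal Vw.toReal d d' ε hd hd2 hdiff (by positivity) hε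
    (by positivity) r1 r2
  have mw : mengerCurv m n w = ENNReal.ofReal (Vw.toReal / d' ^ (m+2)) := by
    rw [mengerCurv, hew, ENNReal.ofReal_div_of_pos (by positivity), ENNReal.ofReal_toReal hwt,
      ENNReal.ofReal_pow hd'.le]
  have mz : mengerCurv m n z = ENNReal.ofReal (Vz.toReal / d ^ (m+2)) := by
    rw [mengerCurv, hez, ENNReal.ofReal_div_of_pos (by positivity), ENNReal.ofReal_toReal hzt,
      ENNReal.ofReal_pow hd.le]
  rw [mw, mz, ← ENNReal.ofReal_add (by positivity) (by positivity)]
  exact ENNReal.ofReal_le_ofReal r3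

/-- **Lemma 5.7** (stability of the discrete curvatures `𝒦_l` under small bilipschitz
perturbations of the identity): if `F = id + G` on `Σ₁` with `lip(G) ≤ ε < 1/2` and
`F(Σ₁) = Σ₂`, then for every `l ∈ {2,…,m+2}` and every non-degenerate `l`-tuple `T` in
`Σ₁`, `|𝒦_l[Σ₂](F^{×l}T) − 𝒦_l[Σ₁](T)| ≤ C ε / diam T`, with `C = C(m)`. -/
theorem discrete_curvature_perturbation (m : ℕ) (hm : 1 ≤ m) :
    ∃ C : ℝ, 0 < C ∧ ∀ n : ℕ, m < n →
      ∀ S₁ S₂ : Set (EuclideanSpace ℝ (Fin n)),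
        IsLipschitzSubmanifold m n S₁ → IsLipschitzSubmanifold m n S₂ →
        ∀ ε : ℝ, 0 < ε → ε < 1 / 2 →
        ∀ F G : EuclideanSpace ℝ (Fin n) → EuclideanSpace ℝ (Fin n),
          (∀ z ∈ S₁, F z = z + G z) → LipschitzOnWith (Real.toNNReal ε) G S₁ →
          F '' S₁ = S₂ →
          ∀ l : ℕ, 2 ≤ l → l ≤ m + 2 →
          ∀ T : Fin l → EuclideanSpace ℝ (Fin n), (∀ i, T i ∈ S₁) →
            (∃ i j, T i ≠ T j) →
            mengerSup m n l S₂ (F ∘ T)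
              ≤ mengerSup m n l S₁ T
                + ENNReal.ofReal (C * ε / Metric.diam (Set.range T)) ∧
            mengerSup m n l S₁ T
              ≤ mengerSup m n l S₂ (F ∘ T)
                + ENNReal.ofReal (C * ε / Metric.diam (Set.range T)) := by
  obtain ⟨C, hC, hcurv⟩ := curv_bound m
  refine ⟨4 * C, by positivity, ?_⟩
  intro n hn S₁ S₂ hS₁ hS₂ ε hε hε2 F G hFG hG hF l hl hl2 T hT hTne
  have hbT : Bornology.IsBounded (Set.range T) := (Set.finite_range _).isBounded
  have hdT : 0 < Metric.diam (Set.range T) := by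
    obtain ⟨i, j, hij⟩ := hTne
    exact (dist_pos.2 hij).trans_le (Metric.dist_le_diam_of_mem hbT ⟨i, rfl⟩ ⟨j, rfl⟩)
  have main : ∀ z : Fin (m + 2) → EuclideanSpace ℝ (Fin n), (∀ i, z i ∈ S₁) →
      ExtendsIn m n l S₁ T z →
      mengerCurv m n (F ∘ z) ≤ mengerCurv m n z
          + ENNReal.ofReal (4 * C * ε / Metric.diam (Set.range T)) ∧
      mengerCurv m n z ≤ mengerCurv m n (F ∘ z)
          + ENNReal.ofReal (4 * C * ε / Metric.diam (Set.range T)) := by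
    intro z hz hext
    have hbz : Bornology.IsBounded (Set.range z) := (Set.finite_range _).isBounded
    have hbw : Bornology.IsBounded (Set.range (F ∘ z)) := (Set.finite_range _).isBounded
    have hsub : Set.range T ⊆ Set.range z := by
      rintro _ ⟨i, rfl⟩
      exact ⟨⟨i, by omega⟩, by simpa using hext.1 ⟨i, by omega⟩ i.2⟩
    have hTz := Metric.diam_mono hsub hbz
    set t := Metric.diam (Set.range T)
    set d := Metric.diam (Set.range z) with hd
    set d' := Metric.diam (Set.range (F ∘ z)) with hd'
    have hz1 : ∀ i j, ‖z i - z j‖ ≤ d := fun i j => by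
      rw [← dist_eq_norm]; exact Metric.dist_le_diam_of_mem hbz ⟨i, rfl⟩ ⟨j, rfl⟩
    have hw1 : ∀ i j, ‖(F ∘ z) i - (F ∘ z) j‖ ≤ d' := fun i j => by
      rw [← dist_eq_norm]; exact Metric.dist_le_diam_of_mem hbw ⟨i, rfl⟩ ⟨j, rfl⟩
    have hd0 : 0 < d := by linarith
    have hdiff : ∀ i j, ‖((F ∘ z) i - (F ∘ z) j) - (z i - z j)‖ ≤ ε * d := by
      intro i j
      have e : ((F ∘ z) i - (F ∘ z) j) - (z i - z j) = G (z i) - G (z j) := by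
        simp only [Function.comp, hFG _ (hz i), hFG _ (hz j)]
        abel
      rw [e, ← dist_eq_norm]
      have h := hG.dist_le_mul _ (hz i) _ (hz j)
      rw [Real.coe_toNNReal _ hε.le, dist_eq_norm (z i)] at h
      exact h.trans (by gcongr; exact hz1 i j)
    have h1 : d ≤ d' + ε * d := by
      refine Metric.diam_le_of_forall_dist_le (by positivity) ?_
      rintro _ ⟨i, rfl⟩ _ ⟨j, rfl⟩
      rw [dist_eq_norm]
      have e : z i - z j = ((F ∘ z) i - (F ∘ z) j) - (((F ∘ z) i - (F ∘ z) j) - (z i - z j)) := by abel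
      rw [e]
      exact (norm_sub_le _ _).trans (add_le_add (hw1 i j) (hdiff i j))
    have h2 : d' ≤ d + ε * d := by
      refine Metric.diam_le_of_forall_dist_le (by positivity) ?_
      rintro _ ⟨i, rfl⟩ _ ⟨j, rfl⟩
      rw [dist_eq_norm]
      have e : (F ∘ z) i - (F ∘ z) j = (z i - z j) + (((F ∘ z) i - (F ∘ z) j) - (z i - z j)) := by abel
      rw [e]
      exact (norm_add_le _ _).trans (add_le_add (hz1 i j) (hdiff i j))
    have hdd1 : d ≤ 2 * d' := by nlinarith
    have hdd2 : d' ≤ 2 * d := by nlinarith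
    have hd0' : 0 < d' := by linarith
    constructor
    · refine (hcurv n ε (F ∘ z) z hε.le hd0 hdd1 hdd2 hdiff).trans ?_
      gcongr
      linarith
    · refine (hcurv n (2 * ε) z (F ∘ z) (by positivity) hd0' hdd2 hdd1 (fun i j => ?_)).trans ?_
      · rw [norm_sub_rev]
        exact (hdiff i j).trans (by nlinarith)
      · refine add_le_add_right (ENNReal.ofReal_le_ofReal ?_) _
        rw [← hd', div_le_div_iff₀ hd0' hdT]
        have : C * (2 * ε) * t ≤ C * (2 * ε) * (2 * d') := by
          gcongr
          linarith
        linarith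
  constructor
  · refine iSup₂_le fun w hw => ?_
    have hex : ∀ i : Fin (m + 2), ∃ x ∈ S₁, F x = w i ∧ ∀ h : (i : ℕ) < l, x = T ⟨i, h⟩ := by
      intro i
      by_cases h : (i : ℕ) < l
      · exact ⟨T ⟨i, h⟩, hT _, (hw.1 i h).symm, fun _ => rfl⟩
      · have := hw.2 i (not_lt.1 h)
        rw [← hF] at this
        obtain ⟨x, hx, hxw⟩ := this
        exact ⟨x, hx, hxw, fun h' => absurd h' h⟩
    choose z hz1 hz2 hz3 using hex
    have hext : ExtendsIn m n l S₁ T z := ⟨fun i h => hz3 i h, fun i _ => hz1 i⟩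
    have hwz : w = F ∘ z := funext fun i => (hz2 i).symm
    rw [hwz]
    refine (main z hz1 hext).1.trans ?_
    gcongr
    exact le_iSup₂ (f := fun z (_ : ExtendsIn m n l S₁ T z) => mengerCurv m n z) z hext
  · refine iSup₂_le fun z hext => ?_
    have hz1 : ∀ i, z i ∈ S₁ := by
      intro i
      by_cases h : (i : ℕ) < l
      · rw [hext.1 i h]; exact hT _
      · exact hext.2 i (not_lt.1 h)
    have hext' : ExtendsIn m n l S₂ (F ∘ T) (F ∘ z) := by
      refine ⟨fun i h => ?_, fun i _ => ?_⟩
      · simp [hext.1 i h]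
      · rw [← hF]; exact ⟨z i, hz1 i, rfl⟩
    refine (main z hz1 hext).2.trans ?_
    gcongr
    exact le_iSup₂ (f := fun z (_ : ExtendsIn m n l S₂ (F ∘ T) z) => mengerCurv m n z) (F ∘ z) hext'
end
end

section
/- Fix an integer m ≥ 1. There is a constant C > 0 depending only on m with the following property. Let 0 < ε < 1/2, let x₁, y₁ ∈ ℝⁿ with x₁ ≠ y₁, and set x₂ = x₁ + g_x, y₂ = y₁ + g_y for vectors g_x, g_y ∈ ℝⁿ with |g_x − g_y| ≤ ε|x₁ − y₁|. Let U₁ be an m-dimensional linear subspace of ℝⁿ and let U₂ = {u + A u : u ∈ U₁} for some linear map A : ℝⁿ → ℝⁿ with operator norm ‖A‖ ≤ ε. Then, setting dᵢ = dist(yᵢ − xᵢ, Uᵢ) for i = 1, 2, one has | 2d₁/|x₁−y₁|² − 2d₂/|x₂−y₂|² | ≤ C · ε / |x₁ − y₁|. -/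
open Set Metric MeasureTheory Filter Topology
open scoped ENNReal NNReal

noncomputable section

theorem tp_arith (r s d₁ d₂ ε : ℝ) (hr : 0 < r) (hε : 0 < ε) (hε2 : ε < 1 / 2)
    (hs1 : s ≤ r + ε * r) (hs2 : r ≤ s + ε * r) (h0 : 0 ≤ d₂) (h2 : d₂ ≤ s)
    (ha : d₂ ≤ d₁ + 7 * (ε * r)) (hb : d₁ ≤ d₂ + 7 * (ε * r)) :
    |2 * d₁ / r ^ 2 - 2 * d₂ / s ^ 2| ≤ 20 * ε / r := by
  have hsr : r ≤ 2 * s := by nlinarith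
  have hs : 0 < s := by linarith
  have e : 2 * d₁ / r ^ 2 - 2 * d₂ / s ^ 2
      = 2 * (d₁ - d₂) / r ^ 2 + 2 * (d₂ / s) * ((s - r) * (s + r)) / (r ^ 2 * s) := by
    field_simp
    ring
  have e1 : |2 * (d₁ - d₂) / r ^ 2| ≤ 14 * ε / r := by
    rw [abs_div, abs_mul, abs_of_pos (by positivity : (0:ℝ) < r ^ 2), abs_two,
      div_le_div_iff₀ (by positivity) hr]
    have : |d₁ - d₂| ≤ 7 * (ε * r) := abs_le.2 ⟨by linarith, by linarith⟩
    nlinarith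
  have e2 : |2 * (d₂ / s) * ((s - r) * (s + r)) / (r ^ 2 * s)| ≤ 6 * ε / r := by
    have hq : d₂ / s ≤ 1 := (div_le_one hs).2 h2
    have hq0 : 0 ≤ d₂ / s := by positivity
    have hd : |s - r| ≤ ε * r := abs_le.2 ⟨by linarith, by linarith⟩
    rw [abs_div, abs_mul, abs_mul, abs_mul, abs_of_pos (by positivity : (0:ℝ) < r ^ 2 * s),
      abs_two, abs_of_nonneg hq0, abs_of_pos (by positivity : 0 < s + r)]
    calc 2 * (d₂ / s) * (|s - r| * (s + r)) / (r ^ 2 * s)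
        ≤ 2 * 1 * ((ε * r) * (3 * s)) / (r ^ 2 * s) := by
          gcongr
          linarith
      _ = 6 * ε / r := by
          field_simp
          ring
  rw [e]
  refine (abs_add_le _ _).trans ((add_le_add e1 e2).trans (le_of_eq ?_))
  ring

/-- **Lemma 5.8** (stability of the inverse tangent-point radius under small bilipschitz
perturbations): with `x₂ = x₁ + g_x`, `y₂ = y₁ + g_y`, `|g_x − g_y| ≤ ε|x₁−y₁|`,
`U₂ = (Id + A)(U₁)`, `‖A‖ ≤ ε < 1/2`, one has
`|1/R_tp(x₁,y₁) − 1/R_tp(x₂,y₂)| ≤ C ε / |x₁−y₁|` with `C = C(m)`, where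
`1/R_tp(x,y) = 2 dist(y−x, U)/|x−y|²`. -/
theorem tangent_point_radius_perturbation (m : ℕ) (hm : 1 ≤ m) :
    ∃ C : ℝ, 0 < C ∧ ∀ (n : ℕ) (ε : ℝ), 0 < ε → ε < 1 / 2 →
      ∀ x₁ y₁ gx gy : EuclideanSpace ℝ (Fin n), x₁ ≠ y₁ →
        ‖gx - gy‖ ≤ ε * ‖x₁ - y₁‖ →
        ∀ U₁ : Submodule ℝ (EuclideanSpace ℝ (Fin n)), Module.finrank ℝ U₁ = m →
        ∀ A : EuclideanSpace ℝ (Fin n) →L[ℝ] EuclideanSpace ℝ (Fin n), ‖A‖ ≤ ε →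
          |2 * Metric.infDist (y₁ - x₁) (U₁ : Set (EuclideanSpace ℝ (Fin n))) / ‖x₁ - y₁‖ ^ 2
            - 2 * Metric.infDist ((y₁ + gy) - (x₁ + gx))
                ((Submodule.map (LinearMap.id + (A : EuclideanSpace ℝ (Fin n) →ₗ[ℝ] EuclideanSpace ℝ (Fin n))) U₁ :
                    Submodule ℝ (EuclideanSpace ℝ (Fin n))) :
                  Set (EuclideanSpace ℝ (Fin n)))
              / ‖(x₁ + gx) - (y₁ + gy)‖ ^ 2|
          ≤ C * ε / ‖x₁ - y₁‖ := by
  refine ⟨20, by norm_num, ?_⟩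
  intro n ε hε hε2 x₁ y₁ gx gy hxy hg U₁ _ A hA
  have hr : 0 < ‖x₁ - y₁‖ := norm_pos_iff.2 (sub_ne_zero.2 hxy)
  set U₂ := Submodule.map (LinearMap.id + (A : EuclideanSpace ℝ (Fin n) →ₗ[ℝ] EuclideanSpace ℝ (Fin n))) U₁ with hU₂
  have hv : (y₁ + gy) - (x₁ + gx) = (y₁ - x₁) - (gx - gy) := by abel
  rw [norm_sub_rev (x₁ + gx), hv]
  rw [norm_sub_rev x₁ y₁] at *
  generalize y₁ - x₁ = w at *
  generalize gx - gy = g at *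
  have hAu : ∀ u, ‖A u‖ ≤ ε * ‖u‖ := fun u => A.le_of_opNorm_le hA u
  have hs1 : ‖w - g‖ ≤ ‖w‖ + ε * ‖w‖ := (norm_sub_le _ _).trans (by linarith)
  have hs2 : ‖w‖ ≤ ‖w - g‖ + ε * ‖w‖ := by
    have := norm_sub_norm_le w g
    linarith
  have h1 : infDist w (U₁ : Set (EuclideanSpace ℝ (Fin n))) ≤ ‖w‖ := by
    simpa using infDist_le_dist_of_mem (x := w) U₁.zero_mem
  have h2 : infDist (w - g) (U₂ : Set (EuclideanSpace ℝ (Fin n))) ≤ ‖w - g‖ := by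
    simpa using infDist_le_dist_of_mem (x := w - g) U₂.zero_mem
  have hεr : 0 < ε * ‖w‖ := by positivity
  refine tp_arith _ _ _ _ _ hr hε hε2 hs1 hs2 infDist_nonneg h2 ?_ ?_
  · obtain ⟨u, hu, hd⟩ := U₁.closed_of_finiteDimensional.exists_infDist_eq_dist ⟨0, U₁.zero_mem⟩ w
    have hm2 : u + A u ∈ (U₂ : Set (EuclideanSpace ℝ (Fin n))) := ⟨u, hu, by simp⟩
    have h3 := infDist_le_dist_of_mem (x := w - g) hm2
    rw [dist_eq_norm] at h3 hd
    have h4 : ‖u‖ ≤ 2 * ‖w‖ := by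
      have := norm_sub_norm_le u w
      rw [norm_sub_rev] at this
      linarith
    have h5 : ‖w - g - (u + A u)‖ ≤ ‖w - u‖ + ‖g‖ + ‖A u‖ := by
      rw [show w - g - (u + A u) = (w - u) - g - A u by abel]
      exact (norm_sub_le _ _).trans (by gcongr; exact norm_sub_le _ _)
    have := hAu u
    nlinarith
  · obtain ⟨z, hz, hd⟩ := U₂.closed_of_finiteDimensional.exists_infDist_eq_dist ⟨0, U₂.zero_mem⟩ (w - g)
    obtain ⟨u, hu, hz⟩ := hz
    have h3 := infDist_le_dist_of_mem (x := w) hu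
    rw [dist_eq_norm] at h3 hd
    have hz : z = u + A u := by
      rw [← hz]
      simp
    rw [hz] at hd
    have hA2 := hAu u
    have h4 : ‖u‖ ≤ 6 * ‖w‖ := by
      have a1 := norm_sub_norm_le (u + A u) (w - g)
      rw [norm_sub_rev (u + A u)] at a1
      have a2 : ‖u‖ ≤ ‖u + A u‖ + ‖A u‖ := by
        simpa using norm_sub_le (u + A u) (A u)
      have a3 : ε * ‖u‖ ≤ 1 / 2 * ‖u‖ := by gcongr
      have a4 : ε * ‖w‖ ≤ 1 / 2 * ‖w‖ := by gcongr
      linarith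
    have h5 : ‖w - u‖ ≤ ‖w - g - (u + A u)‖ + ‖g‖ + ‖A u‖ := by
      have : w - u = (w - g - (u + A u)) + g + A u := by abel
      rw [this]
      exact norm_add₃_le.trans (by simp)
    nlinarith
end
end
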